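/- Let K = (x, y) ∩ (u, v) ∩ (z, q), where x, y, u, v, z are linear forms and q is a quadric, with (x, y), (u, v), (z, q) prime ideals of height 2. If either K = I^un or K = L, then pd(R/I) ≤ 5. -/

import Mathlib

open MvPolynomial Filter CategoryTheory

noncomputable section

/-- The height of an ideal `J`: the infimum of the heights of the prime ideals containing it. -/
def idealHeight {R : Type} [CommRing R] (J : Ideal R) : ℕ∞ :=
  ⨅ p ∈ {p : {q : Ideal R // q.IsPrime} | J ≤ p.1}, Order.height p

/-- `pdQuotLE J n` holds iff `R ⧸ J` admits a projective resolution of length at most `n`,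
i.e. the projective dimension of `R ⧸ J` as an `R`-module is at most `n`. -/
def pdQuotLE {R : Type} [CommRing R] (J : Ideal R) (n : ℕ) : Prop :=
  ∃ P : ProjectiveResolution (ModuleCat.of R (R ⧸ J)),
    ∀ i, n < i → Limits.IsZero (P.complex.X i)

/-- The `p`-primary component of `J` for `p` a minimal prime of `J`:
the saturation of `J` at `p`. -/
def primaryComponent {R : Type} [CommRing R] (J p : Ideal R) : Ideal R :=
  ⨆ (s : R) (_ : s ∉ p), Submodule.colon J (Ideal.span {s})

/-- The unmixed part `J^un` of `J`: the intersection of the primary components of `J`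
corresponding to the minimal primes of `J` of minimal height. -/
def unmixedPart {R : Type} [CommRing R] (J : Ideal R) : Ideal R :=
  ⨅ p ∈ {p : Ideal R | p.IsPrime ∧ J ≤ p ∧ idealHeight p = idealHeight J},
    primaryComponent J p

/-- A linear prime: a prime ideal generated by forms of degree one. -/
def IsLinearPrime {k : Type} [CommSemiring k] {N : ℕ} (p : Ideal (MvPolynomial (Fin N) k)) : Prop :=
  p.IsPrime ∧ ∃ S : Set (MvPolynomial (Fin N) k), (∀ ℓ ∈ S, ℓ.IsHomogeneous 1) ∧ p = Ideal.span S

/-- A homogeneous ideal: an ideal generated by homogeneous elements. -/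
def IsHomogeneousIdeal {k : Type} [CommSemiring k] {N : ℕ}
    (J : Ideal (MvPolynomial (Fin N) k)) : Prop :=
  ∃ S : Set (MvPolynomial (Fin N) k), (∀ g ∈ S, ∃ d, g.IsHomogeneous d) ∧ J = Ideal.span S

/-- `[B]_n`: the ideal generated by all forms of degree `n` belonging to `B`. -/
def degreePart {k : Type} [CommSemiring k] {N : ℕ} (B : Ideal (MvPolynomial (Fin N) k)) (n : ℕ) :
    Ideal (MvPolynomial (Fin N) k) :=
  Ideal.span {f | f ∈ B ∧ f.IsHomogeneous n}

/-- The Hilbert–Samuel function of `R/J` with respect to the irrelevant maximal ideal: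
`n ↦ length (R / (J + 𝔪^n)) = dim_k (R / (J + 𝔪^n))`. -/
def hilbertSamuelFn {k : Type} [Field k] {N : ℕ} (J : Ideal (MvPolynomial (Fin N) k))
    (n : ℕ) : ℕ :=
  Module.finrank k
    (MvPolynomial (Fin N) k ⧸
      (J ⊔ (Ideal.span (Set.range (MvPolynomial.X : Fin N → MvPolynomial (Fin N) k))) ^ n))

/-- `HasMultiplicity J d e`: the quotient `R/J` has Krull dimension `d` and Hilbert–Samuel
multiplicity `e`, expressed through the asymptotics `d! · HS_J(n) / n^d → e` of the
Hilbert–Samuel function. -/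
def HasMultiplicity {k : Type} [Field k] {N : ℕ} (J : Ideal (MvPolynomial (Fin N) k))
    (d e : ℕ) : Prop :=
  Tendsto (fun n : ℕ => (Nat.factorial d : ℝ) * (hilbertSamuelFn J n : ℝ) / (n : ℝ) ^ d)
    atTop (nhds (e : ℝ))

/-- An ideal of `R` is extended from a subalgebra `A` if it is generated by elements of `A`. -/
def extendedFrom {k R : Type} [CommRing k] [CommRing R] [Algebra k R]
    (K : Ideal R) (A : Subalgebra k R) : Prop :=
  ∃ S : Set R, S ⊆ (A : Set R) ∧ K = Ideal.span S


section PD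
variable {R : Type} [CommRing R]

def PDLE (X : Ideal R) (n : ℕ) : Prop :=
  HasProjectiveDimensionLE (ModuleCat.of R (R ⧸ X)) n

lemma PDLE.mono {X : Ideal R} {m n : ℕ} (h : PDLE X m) (hmn : m ≤ n) : PDLE X n :=
  have : HasProjectiveDimensionLT (ModuleCat.of R (R ⧸ X)) (m + 1) := h
  hasProjectiveDimensionLT_of_ge _ (m + 1) (n + 1) (by omega)

lemma pdle_bot : PDLE (⊥ : Ideal R) 0 := by
  have e : (R ⧸ (⊥ : Ideal R)) ≃ₗ[R] R := Submodule.quotEquivOfEqBot _ rfl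
  have : Module.Projective R (R ⧸ (⊥ : Ideal R)) := Module.Projective.of_equiv e.symm
  have : Projective (ModuleCat.of R (R ⧸ (⊥ : Ideal R))) := inferInstance
  exact (projective_iff_hasProjectiveDimensionLE_zero _).1 this

lemma pdle_top : PDLE (⊤ : Ideal R) 0 := by
  have : Subsingleton (R ⧸ (⊤ : Ideal R)) := Submodule.Quotient.subsingleton_iff.2 rfl
  have h : Limits.IsZero (ModuleCat.of R (R ⧸ (⊤ : Ideal R))) := ModuleCat.isZero_of_subsingleton _
  have := h.hasProjectiveDimensionLT_zero
  exact hasProjectiveDimensionLT_of_ge _ 0 1 (by omega)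

/-- The multiplication by `w` map `R/Y → R/X`. -/
def colonMap (X Y : Ideal R) (w : R) (h : ∀ r, r ∈ Y ↔ r * w ∈ X) : (R ⧸ Y) →ₗ[R] (R ⧸ X) :=
  Submodule.mapQ Y X (LinearMap.mulRight R w) (fun r hr => by simpa using (h r).1 hr)

def facMap (X Z : Ideal R) (h : X ≤ Z) : (R ⧸ X) →ₗ[R] (R ⧸ Z) :=
  Submodule.mapQ X Z LinearMap.id (fun r hr => by simpa using h hr)

def colonSES (X Y : Ideal R) (w : R) (h : ∀ r, r ∈ Y ↔ r * w ∈ X) : ShortComplex (ModuleCat R) :=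
  ShortComplex.mk (ModuleCat.ofHom (colonMap X Y w h))
    (ModuleCat.ofHom (facMap X (X ⊔ Ideal.span {w}) le_sup_left)) (by
      ext
      change facMap X (X ⊔ Ideal.span {w}) le_sup_left (colonMap X Y w h (Submodule.Quotient.mk 1)) = 0
      simp only [colonMap, facMap, Submodule.mapQ_apply, Submodule.Quotient.mk_eq_zero]
      simp
      exact Ideal.mem_sup_right (Ideal.mem_span_singleton_self w))

lemma colonSES_shortExact (X Y : Ideal R) (w : R) (h : ∀ r, r ∈ Y ↔ r * w ∈ X) :
    (colonSES X Y w h).ShortExact where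
  exact := by
    rw [ShortComplex.moduleCat_exact_iff]
    intro r hr
    obtain ⟨r, rfl⟩ := Submodule.Quotient.mk_surjective _ r
    have hr' : r ∈ X ⊔ Ideal.span {w} := (Submodule.Quotient.mk_eq_zero _).1 hr
    obtain ⟨a, ha, b, hb, rfl⟩ := Submodule.mem_sup.1 hr'
    obtain ⟨c, rfl⟩ := Ideal.mem_span_singleton'.1 hb
    refine ⟨Submodule.Quotient.mk c, ?_⟩
    change (Submodule.Quotient.mk (c * w) : R ⧸ X) = Submodule.Quotient.mk (a + c * w)
    rw [Submodule.Quotient.eq]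
    simpa using ha
  mono_f := by
    rw [ModuleCat.mono_iff_injective, injective_iff_map_eq_zero]
    intro r hr
    obtain ⟨r, rfl⟩ := Submodule.Quotient.mk_surjective _ r
    have : r * w ∈ X := (Submodule.Quotient.mk_eq_zero _).1 hr
    exact (Submodule.Quotient.mk_eq_zero _).2 ((h r).2 this)
  epi_g := by
    rw [ModuleCat.epi_iff_surjective]
    intro r
    obtain ⟨r, rfl⟩ := Submodule.Quotient.mk_surjective _ r
    exact ⟨Submodule.Quotient.mk r, rfl⟩

lemma pdle_mid {X Y Z : Ideal R} {n : ℕ} (w : R) (h : ∀ r, r ∈ Y ↔ r * w ∈ X)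
    (hZ : X ⊔ Ideal.span {w} = Z) (hY : PDLE Y n) (hZn : PDLE Z n) : PDLE X n := by
  subst hZ
  exact (colonSES_shortExact X Y w h).hasProjectiveDimensionLT_X₂ (n + 1) hY hZn

lemma pdle_right {X Y Z : Ideal R} {n : ℕ} (w : R) (h : ∀ r, r ∈ Y ↔ r * w ∈ X)
    (hZ : X ⊔ Ideal.span {w} = Z) (hY : PDLE Y n) (hX : PDLE X (n + 1)) : PDLE Z (n + 1) := by
  subst hZ
  exact (colonSES_shortExact X Y w h).hasProjectiveDimensionLT_X₃ (n + 1) hY hX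

def infSES (X Y : Ideal R) : ShortComplex (ModuleCat R) :=
  ShortComplex.mk (X₁ := ModuleCat.of R (R ⧸ (X ⊓ Y)))
    (X₂ := ModuleCat.of R ((R ⧸ X) × (R ⧸ Y))) (X₃ := ModuleCat.of R (R ⧸ (X ⊔ Y)))
    (ModuleCat.ofHom ((facMap (X ⊓ Y) X inf_le_left).prod (facMap (X ⊓ Y) Y inf_le_right)))
    (ModuleCat.ofHom ((facMap X (X ⊔ Y) le_sup_left).coprod (-facMap Y (X ⊔ Y) le_sup_right))) (by
      ext
      change facMap X (X ⊔ Y) le_sup_left (Submodule.Quotient.mk 1) +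
        -facMap Y (X ⊔ Y) le_sup_right (Submodule.Quotient.mk 1) = 0
      simp [facMap])

lemma infSES_shortExact (X Y : Ideal R) : (infSES X Y).ShortExact where
  exact := by
    rw [ShortComplex.moduleCat_exact_iff]
    rintro ⟨r, s⟩ hr
    obtain ⟨r, rfl⟩ := Submodule.Quotient.mk_surjective _ r
    obtain ⟨s, rfl⟩ := Submodule.Quotient.mk_surjective _ s
    have hr' : (Submodule.Quotient.mk r : R ⧸ (X ⊔ Y)) + - Submodule.Quotient.mk s = 0 := hr
    rw [← sub_eq_add_neg, sub_eq_zero, Submodule.Quotient.eq] at hr'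
    obtain ⟨a, ha, b, hb, hab⟩ := Submodule.mem_sup.1 hr'
    refine ⟨Submodule.Quotient.mk (r - a), ?_⟩
    change ((Submodule.Quotient.mk (r - a) : R ⧸ X), (Submodule.Quotient.mk (r - a) : R ⧸ Y)) =
      (Submodule.Quotient.mk r, Submodule.Quotient.mk s)
    rw [Prod.mk.injEq, Submodule.Quotient.eq, Submodule.Quotient.eq]
    constructor
    · simpa using ha
    · have : r - a - s = b := by linear_combination -hab
      rwa [this]
  mono_f := by
    rw [ModuleCat.mono_iff_injective, injective_iff_map_eq_zero]
    intro r hr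
    obtain ⟨r, rfl⟩ := Submodule.Quotient.mk_surjective _ r
    have h' : ((Submodule.Quotient.mk r : R ⧸ X), (Submodule.Quotient.mk r : R ⧸ Y)) = 0 := hr
    rw [Prod.mk_eq_zero] at h'
    exact (Submodule.Quotient.mk_eq_zero _).2 ⟨(Submodule.Quotient.mk_eq_zero _).1 h'.1,
      (Submodule.Quotient.mk_eq_zero _).1 h'.2⟩
  epi_g := by
    rw [ModuleCat.epi_iff_surjective]
    intro r
    obtain ⟨r, rfl⟩ := Submodule.Quotient.mk_surjective _ r
    refine ⟨(Submodule.Quotient.mk r, 0), ?_⟩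
    change (Submodule.Quotient.mk r : R ⧸ (X ⊔ Y)) + - facMap Y (X ⊔ Y) le_sup_right 0 = _
    simp

lemma pdle_inf {X Y : Ideal R} {n : ℕ} (hX : PDLE X n) (hY : PDLE Y n)
    (hXY : PDLE (X ⊔ Y) (n + 1)) : PDLE (X ⊓ Y) n := by
  refine (infSES_shortExact X Y).hasProjectiveDimensionLT_X₁ (n + 1) ?_ hXY
  have : HasProjectiveDimensionLT (ModuleCat.of R (R ⧸ X)) (n + 1) := hX
  have : HasProjectiveDimensionLT (ModuleCat.of R (R ⧸ Y)) (n + 1) := hY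
  exact hasProjectiveDimensionLT_of_iso
    (ModuleCat.biprodIsoProd (ModuleCat.of R (R ⧸ X)) (ModuleCat.of R (R ⧸ Y))) (n + 1)

/-- Splicing: a resolution of length `≤ n` exists when the projective dimension is
at most `n`. -/
lemma exists_complex (n : ℕ) : ∀ (M : ModuleCat.{0} R), HasProjectiveDimensionLE M n →
    ∃ (C : ChainComplex (ModuleCat.{0} R) ℕ) (ε : C.X 0 ⟶ M) (w : C.d 1 0 ≫ ε = 0),
      (∀ i, Projective (C.X i)) ∧ Epi ε ∧ (ShortComplex.mk _ _ w).Exact ∧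
      (∀ i, C.ExactAt (i + 1)) ∧ ∀ i, n < i → Limits.IsZero (C.X i) := by
  induction n with
  | zero =>
    intro M hM
    have hp : Projective M := (projective_iff_hasProjectiveDimensionLE_zero _).2 hM
    let Z : ChainComplex (ModuleCat.{0} R) ℕ := HomologicalComplex.zero
    have hZ : ∀ i, Limits.IsZero (Z.X i) := fun i => Limits.isZero_zero _
    let C := ChainComplex.augment Z (0 : Z.X 0 ⟶ M) (by simp)
    have hC : ∀ i, Limits.IsZero (C.X (i + 1)) := fun i => hZ i
    refine ⟨C, 𝟙 M, (hC 0).eq_of_src _ _, ?_, inferInstanceAs (Epi (𝟙 M)), ?_, ?_, ?_⟩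
    · rintro (_ | i)
      · exact hp
      · exact (hC i).projective
    · rw [ShortComplex.moduleCat_exact_iff]
      intro x hx
      refine ⟨0, ?_⟩
      rw [map_zero]
      exact hx.symm
    · intro i
      rw [HomologicalComplex.exactAt_iff]
      exact ShortComplex.exact_of_isZero_X₂ _ (hC i)
    · rintro (_ | i) hi
      · omega
      · exact hC i
  | succ n ih =>
    intro M hM
    let S : ShortComplex (ModuleCat.{0} R) := ShortComplex.mk (Limits.kernel.ι (Projective.π M))
      (Projective.π M) (by simp)
    have hS : S.ShortExact :=
      { exact := ShortComplex.exact_kernel _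
        mono_f := by dsimp [S]; infer_instance
        epi_g := by dsimp [S]; infer_instance }
    have hN : HasProjectiveDimensionLE S.X₁ n :=
      (hS.hasProjectiveDimensionLT_X₃_iff n (by dsimp [S]; infer_instance)).1 hM
    obtain ⟨Q, ε, w, hp, he, hex, hexs, hz⟩ := ih S.X₁ hN
    have hmono := hS.mono_f
    have hw : Q.d 1 0 ≫ ε ≫ S.f = 0 := by
      rw [← Category.assoc, w, Limits.zero_comp]
    let C := ChainComplex.augment Q (ε ≫ S.f) hw
    have hex1 : (ShortComplex.mk _ _ hw).Exact := by
      rw [ShortComplex.moduleCat_exact_iff] at hex ⊢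
      intro x hx
      refine hex x ?_
      apply (ModuleCat.mono_iff_injective S.f).1 hmono
      rw [map_zero]
      simpa using hx
    refine ⟨C, S.g, ?_, ?_, hS.epi_g, ?_, ?_, ?_⟩
    · change (ε ≫ S.f) ≫ S.g = 0
      rw [Category.assoc, S.zero, Limits.comp_zero]
    · rintro (_ | i)
      · change Projective S.X₂
        dsimp [S]; infer_instance
      · exact hp i
    · have h2 := hS.exact
      rw [ShortComplex.moduleCat_exact_iff] at h2 ⊢
      intro x hx
      obtain ⟨y, hy⟩ := h2 x hx
      obtain ⟨y', rfl⟩ := (ModuleCat.epi_iff_surjective ε).1 he y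
      exact ⟨y', hy⟩
    · intro i
      rw [HomologicalComplex.exactAt_iff' _ (i + 2) (i + 1) i (by simp) (by simp)]
      cases i with
      | zero => exact hex1
      | succ i =>
        have := hexs i
        rw [HomologicalComplex.exactAt_iff' _ (i + 2) (i + 1) i (by simp) (by simp)] at this
        exact this
    · rintro (_ | i) hi
      · omega
      · exact hz i (by omega)

lemma PDLE.pdQuotLE {X : Ideal R} {n : ℕ} (h : PDLE X n) : pdQuotLE X n := by
  obtain ⟨C, ε, w, hp, he, hex, hexs, hz⟩ := exists_complex n _ h
  let π := (ChainComplex.toSingle₀Equiv C (ModuleCat.of R (R ⧸ X))).symm ⟨ε, w⟩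
  have hπ : QuasiIso π := ⟨fun m => by
    cases m
    · rw [ChainComplex.quasiIsoAt₀_iff, ShortComplex.quasiIso_iff_of_zeros']
      · refine (ShortComplex.exact_and_epi_g_iff_of_iso ?_).2 ⟨hex, he⟩
        exact ShortComplex.isoMk (Iso.refl _) (Iso.refl _) (Iso.refl _)
          ((Category.id_comp _).trans (Category.comp_id _).symm)
          (by
            refine (Category.id_comp _).trans (Eq.trans ?_ (Category.comp_id _).symm)
            simp [π]
            rfl)
      · exact C.shape _ _ (by simp)
      all_goals rfl
    · rw [quasiIsoAt_iff_exactAt']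
      · apply hexs
      · apply ChainComplex.exactAt_succ_single_obj⟩
  exact ⟨{ complex := C, projective := hp, π := π, quasiIso := hπ }, hz⟩

end PD



section Lin
variable {k : Type} [Field k] {N : ℕ}

lemma isHomogeneous_one_eq (f : MvPolynomial (Fin N) k) (hf : f.IsHomogeneous 1) :
    ∃ c : Fin N → k, f = ∑ i, C (c i) * X i := by
  have h : f ∈ homogeneousSubmodule (Fin N) k 1 := hf
  rw [homogeneousSubmodule_one_eq_span_X, Submodule.mem_span_range_iff_exists_fun] at h
  obtain ⟨c, hc⟩ := h
  exact ⟨c, by simp [← hc, MvPolynomial.smul_eq_C_mul]⟩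

/-- Ideals generated by linear forms. -/
def IsLin (E : Ideal (MvPolynomial (Fin N) k)) : Prop :=
  ∃ S : Set (MvPolynomial (Fin N) k), (∀ l ∈ S, l.IsHomogeneous 1) ∧ E = Ideal.span S

lemma IsLin.sup {E F : Ideal (MvPolynomial (Fin N) k)} (hE : IsLin E) (hF : IsLin F) :
    IsLin (E ⊔ F) := by
  obtain ⟨S, hS, rfl⟩ := hE
  obtain ⟨T, hT, rfl⟩ := hF
  refine ⟨S ∪ T, ?_, (Ideal.span_union S T).symm⟩
  rintro l (h | h)
  · exact hS l h
  · exact hT l h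

lemma isLin_singleton {x : MvPolynomial (Fin N) k} (hx : x.IsHomogeneous 1) :
    IsLin (Ideal.span {x}) :=
  ⟨{x}, by rintro l rfl; exact hx, rfl⟩

lemma span_pair_sup {R : Type} [CommRing R] (x y : R) :
    Ideal.span {x, y} = Ideal.span {x} ⊔ Ideal.span {y} := by
  rw [← Ideal.span_union]; rfl

lemma isLin_pair {x y : MvPolynomial (Fin N) k} (hx : x.IsHomogeneous 1) (hy : y.IsHomogeneous 1) :
    IsLin (Ideal.span {x, y}) := by
  rw [span_pair_sup]
  exact (isLin_singleton hx).sup (isLin_singleton hy)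

lemma IsLin.exists_ker {E : Ideal (MvPolynomial (Fin N) k)} (hE : IsLin E) :
    ∃ (m : ℕ) (π : MvPolynomial (Fin N) k →ₐ[k] MvPolynomial (Fin m) k),
      Function.Surjective π ∧ RingHom.ker π = E := by
  obtain ⟨S, hS, rfl⟩ := hE
  let φ : (Fin N → k) →ₗ[k] MvPolynomial (Fin N) k :=
    Fintype.linearCombination k (X : Fin N → MvPolynomial (Fin N) k)
  have hφ : ∀ c, φ c = ∑ i, C (c i) * X i := fun c => by
    simp [φ, Fintype.linearCombination_apply, MvPolynomial.smul_eq_C_mul]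
  let V : Submodule k (Fin N → k) := Submodule.comap φ (Submodule.span k S)
  let b := Module.finBasis k ((Fin N → k) ⧸ V)
  let m := Module.finrank k ((Fin N → k) ⧸ V)
  let ψ : (Fin N → k) →ₗ[k] MvPolynomial (Fin m) k :=
    (b.constr k (X : Fin m → MvPolynomial (Fin m) k)).comp V.mkQ
  let π : MvPolynomial (Fin N) k →ₐ[k] MvPolynomial (Fin m) k :=
    aeval (fun i => ψ (Pi.single i 1))
  have hπφ : ∀ c, π (φ c) = ψ c := by
    intro c
    have : (π.toLinearMap.comp φ) = ψ := by
      apply LinearMap.pi_ext'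
      intro i
      ext
      simp [φ, π, Fintype.linearCombination_apply, Pi.single_apply]
    exact LinearMap.congr_fun this c
  have hlift : ∀ j, ∃ c, V.mkQ c = b j := fun j => V.mkQ_surjective (b j)
  choose c hc using hlift
  let σ : MvPolynomial (Fin m) k →ₐ[k] MvPolynomial (Fin N) k := aeval (fun j => φ (c j))
  have hψc : ∀ j, ψ (c j) = X j := by
    intro j
    change b.constr k X (V.mkQ (c j)) = X j
    rw [hc, Module.Basis.constr_basis]
  have hπσ : π.comp σ = AlgHom.id k _ := by
    ext j : 1
    simp only [AlgHom.comp_apply, σ, aeval_X, hπφ, hψc, AlgHom.id_apply]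
  refine ⟨m, π, fun r => ⟨σ r, AlgHom.congr_fun hπσ r⟩, le_antisymm ?_ ?_⟩
  · have hVS : ∀ v ∈ V, φ v ∈ Ideal.span S := by
      intro v hv
      exact Submodule.span_le_restrictScalars k (MvPolynomial (Fin N) k) S hv
    have key : (Ideal.Quotient.mkₐ k (Ideal.span S)).comp (σ.comp π) =
        Ideal.Quotient.mkₐ k (Ideal.span S) := by
      ext i : 1
      simp only [AlgHom.comp_apply, Ideal.Quotient.mkₐ_eq_mk]
      rw [Ideal.Quotient.eq]
      have h1 : π (X i) = ψ (Pi.single i 1) := by simp [π]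
      have h2 : (X i : MvPolynomial (Fin N) k) = φ (Pi.single i 1) := by
        simp [φ, Fintype.linearCombination_apply, Pi.single_apply]
      have h3 : ∀ e, σ (ψ e) = φ (∑ j, b.repr (V.mkQ e) j • c j) := by
        intro e
        simp only [ψ, LinearMap.comp_apply, Module.Basis.constr_apply_fintype, map_sum, map_smul,
          Module.Basis.equivFun_apply, σ, aeval_X]
      rw [h1, h3, h2, ← map_sub]
      apply hVS
      rw [← Submodule.Quotient.mk_eq_zero, Submodule.Quotient.mk_sub, sub_eq_zero]
      change V.mkQ _ = V.mkQ _
      rw [map_sum]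
      simp only [map_smul, hc]
      exact b.sum_repr _
    intro r hr
    have := AlgHom.congr_fun key r
    simp only [AlgHom.comp_apply] at this
    rw [RingHom.mem_ker] at hr
    have hr' : π r = 0 := hr
    rw [hr', map_zero, map_zero] at this
    exact Ideal.Quotient.eq_zero_iff_mem.1 this.symm
  · rw [Ideal.span_le]
    intro s hs
    obtain ⟨e, he⟩ := isHomogeneous_one_eq s (hS s hs)
    rw [← hφ] at he
    have heV : e ∈ V := by
      change φ e ∈ Submodule.span k S
      rw [← he]; exact Submodule.subset_span hs
    change π s = 0
    rw [he, hπφ]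
    change b.constr k X (V.mkQ e) = 0
    have : V.mkQ e = 0 := (Submodule.Quotient.mk_eq_zero _).2 heV
    rw [this, map_zero]

lemma IsLin.isPrime {E : Ideal (MvPolynomial (Fin N) k)} (hE : IsLin E) : E.IsPrime := by
  obtain ⟨m, π, hπ, rfl⟩ := hE.exists_ker
  exact RingHom.ker_isPrime _

lemma IsLin.ufd {E : Ideal (MvPolynomial (Fin N) k)} (hE : IsLin E) :
    UniqueFactorizationMonoid (MvPolynomial (Fin N) k ⧸ E) := by
  obtain ⟨m, π, hπ, rfl⟩ := hE.exists_ker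
  have e := Ideal.quotientKerAlgEquivOfSurjective hπ
  exact e.symm.toMulEquiv.uniqueFactorizationMonoid inferInstance

lemma pdle_prime_sup {R : Type} [CommRing R] {X : Ideal R} {n : ℕ} (hX : X.IsPrime) (hn : PDLE X n)
    (w : R) : PDLE (X ⊔ Ideal.span {w}) (n + 1) := by
  by_cases hw : w ∈ X
  · rw [sup_of_le_left (by rwa [Ideal.span_singleton_le_iff_mem])]
    exact hn.mono (by omega)
  · refine pdle_right w (fun r => ⟨fun h => X.mul_mem_right _ h, fun h => ?_⟩) rfl hn
      (hn.mono (by omega))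
    exact (hX.mem_or_mem h).resolve_right hw

lemma IsLin.pdle_sup {E : Ideal (MvPolynomial (Fin N) k)} (hE : IsLin E) {n : ℕ} (hn : PDLE E n)
    (w : MvPolynomial (Fin N) k) : PDLE (E ⊔ Ideal.span {w}) (n + 1) :=
  pdle_prime_sup hE.isPrime hn w

lemma pdle_single {x : MvPolynomial (Fin N) k} : PDLE (Ideal.span {x}) 1 := by
  have := pdle_prime_sup (Ideal.isPrime_bot (α := MvPolynomial (Fin N) k)) pdle_bot x
  rwa [bot_sup_eq] at this

lemma pdle_lin_pair {x y : MvPolynomial (Fin N) k} (hx : x.IsHomogeneous 1) :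
    PDLE (Ideal.span {x, y}) 2 := by
  rw [span_pair_sup]
  exact (isLin_singleton hx).pdle_sup pdle_single y

lemma IsLin.pdle_sup_pair {E : Ideal (MvPolynomial (Fin N) k)} (hE : IsLin E) {n : ℕ}
    (hn : PDLE E n) {x y : MvPolynomial (Fin N) k} (hx : x.IsHomogeneous 1) :
    PDLE (E ⊔ Ideal.span {x, y}) (n + 2) := by
  rw [span_pair_sup, ← sup_assoc]
  exact (hE.sup (isLin_singleton hx)).pdle_sup (hE.pdle_sup hn x) y

end Lin


section Nagata
open Polynomial MvPolynomial Ideal Nat RingHom List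
variable {k : Type*} [Field k] {n : ℕ} (f : MvPolynomial (Fin (n+1)) k) (v w : Fin (n+1) →₀ ℕ)

variable {f v} in
lemma lt_up (vlt : ∀ i, v i < (2 + f.totalDegree)) : ∀ l ∈ ofFn v, l < (2 + f.totalDegree) := by
  grind


/-- We construct an algebra map `nagT1 f c` which maps `X_i` into `X_i + c • X_0 ^ r_i` when `i ≠ 0`
and `X_0` to `X_0`. -/
noncomputable abbrev nagT1 (c : k) :
    MvPolynomial (Fin (n + 1)) k →ₐ[k] MvPolynomial (Fin (n + 1)) k :=
  aeval fun i ↦ if i = 0 then X 0 else X i + c • X 0 ^ ((2 + f.totalDegree) ^ i.1)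

lemma t1_comp_t1_neg (c : k) : (nagT1 f c).comp (nagT1 f (-c)) = AlgHom.id _ _ := by
  rw [comp_aeval, ← MvPolynomial.aeval_X_left]
  ext i v
  cases i using Fin.cases <;> simp

/-- `nagT1 f 1` leads to an algebra equiv `nagT f`. -/
noncomputable abbrev nagT := AlgEquiv.ofAlgHom (nagT1 f 1) (nagT1 f (-1))
  (t1_comp_t1_neg f 1) (by simpa using t1_comp_t1_neg f (-1))

lemma sum_r_mul_ne (vlt : ∀ i, v i < (2 + f.totalDegree)) (wlt : ∀ i, w i < (2 + f.totalDegree)) (ne : v ≠ w) :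
    ∑ x : Fin (n + 1), ((2 + f.totalDegree) ^ x.1) * v x ≠ ∑ x : Fin (n + 1), ((2 + f.totalDegree) ^ x.1) * w x := by
  intro h
  refine ne <| Finsupp.ext <| congrFun <| ofFn_inj.mp ?_
  apply ofDigits_inj_of_len_eq (Nat.lt_add_right f.totalDegree one_lt_two)
    (by simp) (lt_up vlt) (lt_up wlt)
  simpa only [ofDigits_eq_sum_mapIdx, mapIdx_eq_ofFn, get_ofFn, length_ofFn,
    Fin.val_cast, mul_comm, sum_ofFn] using! h

lemma degreeOf_zero_t {a : k} (ha : a ≠ 0) : ((nagT f) (monomial v a)).degreeOf 0 =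
    ∑ i : Fin (n + 1), ((2 + f.totalDegree) ^ i.1) * v i := by
  rw [← natDegree_finSuccEquiv, monomial_eq, Finsupp.prod_pow v fun a ↦ X a]
  simp only [Fin.prod_univ_succ, Fin.sum_univ_succ, map_mul, map_prod, map_pow,
    AlgEquiv.ofAlgHom_apply, MvPolynomial.aeval_C, MvPolynomial.aeval_X, if_pos, Fin.succ_ne_zero,
    ite_false, one_smul, map_add, finSuccEquiv_X_zero, finSuccEquiv_X_succ, algebraMap_eq]
  have h (i : Fin n) :
      (Polynomial.C (X (R := k) i) + Polynomial.X ^ ((2 + f.totalDegree) ^ (i.succ).1)) ^ v i.succ ≠ 0 :=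
    pow_ne_zero (v i.succ) (leadingCoeff_ne_zero.mp <| by simp [add_comm, leadingCoeff_X_pow_add_C])
  rw [natDegree_mul (by simp [ha]) (mul_ne_zero (by simp) (Finset.prod_ne_zero_iff.mpr
    (fun i _ ↦ h i))), natDegree_mul (by simp) (Finset.prod_ne_zero_iff.mpr (fun i _ ↦ h i)),
    natDegree_prod _ _ (fun i _ ↦ h i), natDegree_finSuccEquiv, degreeOf_C]
  simpa only [natDegree_pow, zero_add, natDegree_X, mul_one, Fin.val_zero, pow_zero, one_mul,
    add_right_inj] using Finset.sum_congr rfl (fun i _ ↦ by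
    rw [add_comm (Polynomial.C _), natDegree_X_pow_add_C, mul_comm])

/-- `nagT` maps different monomials of `f` to polynomials with different degrees in `X_0`. -/
lemma degreeOf_t_ne_of_ne (hv : v ∈ f.support) (hw : w ∈ f.support) (ne : v ≠ w) :
    (nagT f <| monomial v <| coeff v f).degreeOf 0 ≠
    (nagT f <| monomial w <| coeff w f).degreeOf 0 := by
  rw [degreeOf_zero_t _ _ <| mem_support_iff.mp hv, degreeOf_zero_t _ _ <| mem_support_iff.mp hw]
  refine sum_r_mul_ne f v w (fun i ↦ ?_) (fun i ↦ ?_) ne <;>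
  exact lt_of_le_of_lt ((monomial_le_degreeOf i ‹_›).trans (degreeOf_le_totalDegree f i))
    (by lia)

lemma leadingCoeff_finSuccEquiv_t :
    (finSuccEquiv k n ((nagT f) ((monomial v) (coeff v f)))).leadingCoeff =
    algebraMap k _ (coeff v f) := by
  rw [monomial_eq, Finsupp.prod_fintype]
  · simp only [map_mul, map_prod, leadingCoeff_mul, leadingCoeff_prod]
    rw [AlgEquiv.ofAlgHom_apply, algHom_C, algebraMap_eq, finSuccEquiv_apply,
      eval₂Hom_C, coe_comp]
    simp only [AlgEquiv.ofAlgHom_apply, Function.comp_apply, leadingCoeff_C, map_pow,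
      leadingCoeff_pow, algebraMap_eq]
    have : ∀ j, ((finSuccEquiv k n) ((nagT1 f) 1 (X j))).leadingCoeff = 1 := fun j ↦ by
      by_cases h : j = 0
      · simp [h, finSuccEquiv_apply]
      · simp only [aeval_eq_bind₁, bind₁_X_right, if_neg h, one_smul, map_add, map_pow]
        obtain ⟨i, rfl⟩ := Fin.exists_succ_eq.mpr h
        simp [finSuccEquiv_X_succ, finSuccEquiv_X_zero, add_comm]
    simp only [this, one_pow, Finset.prod_const_one, mul_one]
  exact fun i ↦ pow_zero _

/-- `nagT` maps `f` into some polynomial in `X_0` such that the leading coefficient is invertible. -/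
lemma T_leadingcoeff_isUnit (fne : f ≠ 0) :
    IsUnit (finSuccEquiv k n (nagT f f)).leadingCoeff := by
  obtain ⟨v, vin, vs⟩ := Finset.exists_max_image f.support
    (fun v ↦ (nagT f ((monomial v) (coeff v f))).degreeOf 0) (support_nonempty.mpr fne)
  set h := fun w ↦ (MvPolynomial.monomial w) (coeff w f)
  simp only [← natDegree_finSuccEquiv] at vs
  replace vs : ∀ x ∈ f.support \ {v}, (finSuccEquiv k n ((nagT f) (h x))).degree <
      (finSuccEquiv k n ((nagT f) (h v))).degree := by
    intro x hx
    obtain ⟨h1, h2⟩ := Finset.mem_sdiff.mp hx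
    apply degree_lt_degree <| lt_of_le_of_ne (vs x h1) ?_
    simpa only [natDegree_finSuccEquiv]
      using degreeOf_t_ne_of_ne f _ _ h1 vin <| ne_of_not_mem_cons h2
  have coeff : (finSuccEquiv k n ((nagT f) (h v + ∑ x ∈ f.support \ {v}, h x))).leadingCoeff =
      (finSuccEquiv k n ((nagT f) (h v))).leadingCoeff := by
    simp only [map_add, map_sum]
    rw [add_comm]
    apply leadingCoeff_add_of_degree_lt <| (lt_of_le_of_lt <| degree_sum_le _ _) ?_
    have h2 : h v ≠ 0 := by simpa [h] using mem_support_iff.mp vin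
    replace h2 : (finSuccEquiv k n ((nagT f) (h v))) ≠ 0 := fun eq ↦ h2 <|
      by simpa only [map_eq_zero_iff _ (AlgEquiv.injective _)] using eq
    exact (Finset.sup_lt_iff <| Ne.bot_lt (fun x ↦ h2 <| degree_eq_bot.mp x)).mpr vs
  nth_rw 2 [← f.support_sum_monomial_coeff]
  rw [Finset.sum_eq_add_sum_sdiff_singleton_of_mem vin h]
  rw [leadingCoeff_finSuccEquiv_t] at coeff
  simpa only [coeff, algebraMap_eq] using (mem_support_iff.mp vin).isUnit.map MvPolynomial.C

end Nagata


section Triple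

def RegPair {R : Type*} [CommRing R] (a b : R) : Prop :=
  ∀ r s, a * r = b * s → ∃ t, r = b * t ∧ s = a * t

def HasTriple {R : Type*} [CommRing R] (p : Ideal R) : Prop :=
  ∃ a ∈ p, ∃ b ∈ p, ∃ h ∈ p, a ≠ 0 ∧ RegPair a b ∧
    ∀ c, h * c ∈ Ideal.span {a, b} → c ∈ Ideal.span {a, b}

lemma comap_C_lt {P : Type*} [CommRing P] {q1 q2 q3 : Ideal (Polynomial P)} [hq2 : q2.IsPrime]
    (h12 : q1 ≤ q2) (h23 : q2 < q3) {h : Polynomial P} (hm : h.Monic) (hh : h ∈ q1) :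
    q2.comap Polynomial.C < q3.comap Polynomial.C := by
  obtain ⟨hle, r, hr3, hr2⟩ := SetLike.lt_iff_le_and_exists.1 h23
  have hIntg := hm.quotient_isIntegral hh
  obtain ⟨p, hp, hp0⟩ := hIntg (Ideal.Quotient.mk q1 r)
  refine Ideal.comap_lt_comap_of_root_mem_sdiff hle ⟨hr3, hr2⟩ (p := p) ?_ ?_
  · exact (hp.map _).ne_zero
  · apply h12
    rw [← Ideal.Quotient.eq_zero_iff_mem, Polynomial.hom_eval₂]
    exact hp0

lemma hasTriple_poly {P : Type*} [CommRing P] [IsDomain P] [UniqueFactorizationMonoid P]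
    {q1 q2 q3 : Ideal (Polynomial P)} [q1.IsPrime] [q2.IsPrime] [q3.IsPrime]
    (h12 : q1 < q2) (h23 : q2 < q3) {h : Polynomial P} (hm : h.Monic) (hh : h ∈ q1) :
    HasTriple q3 := by
  have l12 := comap_C_lt le_rfl h12 hm hh
  have l23 := comap_C_lt h12.le h23 hm hh
  have hne : q2.comap Polynomial.C ≠ ⊥ := fun h0 => by
    rw [h0] at l12; exact not_lt_bot l12
  obtain ⟨a, ha, hap⟩ := Ideal.IsPrime.exists_mem_prime_of_ne_bot
    (inferInstance : (q2.comap Polynomial.C).IsPrime) hne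
  obtain ⟨-, b, hb3, hb2⟩ := SetLike.lt_iff_le_and_exists.1 l23
  have hab : ¬ a ∣ b := fun hd => hb2 (Ideal.mem_of_dvd _ hd ha)
  have hmem : ∀ g : Polynomial P, g ∈ Ideal.span {Polynomial.C a, Polynomial.C b} ↔
      ∀ n, g.coeff n ∈ Ideal.span {a, b} := by
    intro g
    rw [← Ideal.mem_map_C_iff, Ideal.map_span, Set.image_pair]
  refine ⟨Polynomial.C a, h23.le ha, Polynomial.C b, hb3, h, h23.le (h12.le hh), ?_, ?_, ?_⟩
  · simpa using hap.ne_zero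
  · intro r s hrs
    have h1 : Polynomial.C a ∣ s := by
      rw [Polynomial.C_dvd_iff_dvd_coeff]
      intro i
      have h2 : a * r.coeff i = b * s.coeff i := by
        simpa using congrArg (fun g => Polynomial.coeff g i) hrs
      exact (hap.dvd_or_dvd ⟨_, h2.symm⟩).resolve_left hab
    obtain ⟨t, rfl⟩ := h1
    refine ⟨t, ?_, rfl⟩
    have h0 : Polynomial.C a ≠ 0 := by simpa using hap.ne_zero
    apply mul_left_cancel₀ h0
    rw [hrs]; ring
  · intro c hc
    rw [hmem] at hc ⊢
    set A : Ideal P := Ideal.span {a, b}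
    have h1 : (h.map (Ideal.Quotient.mk A)) * (c.map (Ideal.Quotient.mk A)) = 0 := by
      rw [← Polynomial.map_mul]
      ext i
      rw [Polynomial.coeff_map, Polynomial.coeff_zero]
      exact Ideal.Quotient.eq_zero_iff_mem.2 (hc i)
    have h2 : c.map (Ideal.Quotient.mk A) = 0 := by
      have := (hm.map (Ideal.Quotient.mk A)).mul_right_eq_zero_iff.1 h1
      exact this
    intro i
    rw [← Ideal.Quotient.eq_zero_iff_mem, ← Polynomial.coeff_map, h2, Polynomial.coeff_zero]

lemma HasTriple.of_comap {R S : Type*} [CommRing R] [CommRing S] (e : R ≃+* S) {p : Ideal R}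
    (h : HasTriple (p.comap (e.symm : S →+* R))) : HasTriple p := by
  obtain ⟨a, ha, b, hb, h, hh, h0, h1, h2⟩ := h
  have hm : ∀ c, c ∈ Ideal.span {e.symm a, e.symm b} ↔ e c ∈ Ideal.span {a, b} := by
    intro c
    simp only [Ideal.mem_span_pair]
    constructor
    · rintro ⟨r, s, rfl⟩
      exact ⟨e r, e s, by simp⟩
    · rintro ⟨r, s, h⟩
      refine ⟨e.symm r, e.symm s, ?_⟩
      apply e.injective
      simp [← h]
  refine ⟨e.symm a, ha, e.symm b, hb, e.symm h, hh, by simpa using h0, ?_, ?_⟩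
  · intro r s hrs
    have := congrArg e hrs
    simp only [map_mul, RingEquiv.apply_symm_apply] at this
    obtain ⟨t, ht1, ht2⟩ := h1 _ _ this
    refine ⟨e.symm t, ?_, ?_⟩ <;> apply e.injective <;> simp [ht1, ht2]
  · intro c hc
    rw [hm] at hc ⊢
    apply h2
    simpa using hc

lemma hasTriple_mvPoly {k : Type} [Field k] {N : ℕ} {p0 p1 p2 p3 : Ideal (MvPolynomial (Fin N) k)}
    (hp1 : p1.IsPrime) (hp2 : p2.IsPrime) (hp3 : p3.IsPrime)
    (h01 : p0 < p1) (h12 : p1 < p2) (h23 : p2 < p3) : HasTriple p3 := by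
  obtain ⟨-, f, hf1, hf0⟩ := SetLike.lt_iff_le_and_exists.1 h01
  have hf : f ≠ 0 := fun h => hf0 (h ▸ p0.zero_mem)
  cases N with
  | zero =>
    exfalso
    rw [MvPolynomial.eq_C_of_isEmpty f] at hf1 hf
    exact hp1.ne_top (Ideal.eq_top_of_isUnit_mem _ hf1
      ((isUnit_iff_ne_zero.2 (by simpa using hf)).map MvPolynomial.C))
  | succ n =>
    let e : MvPolynomial (Fin (n+1)) k ≃+* Polynomial (MvPolynomial (Fin n) k) :=
      ((nagT f).trans (finSuccEquiv k n)).toRingEquiv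
    have hu : IsUnit (e f).leadingCoeff := T_leadingcoeff_isUnit f hf
    apply HasTriple.of_comap e
    have hlt : ∀ {p q : Ideal (MvPolynomial (Fin (n+1)) k)}, p < q →
        p.comap (e.symm : Polynomial (MvPolynomial (Fin n) k) →+* MvPolynomial (Fin (n+1)) k) <
        q.comap (e.symm : Polynomial (MvPolynomial (Fin n) k) →+* MvPolynomial (Fin (n+1)) k) := by
      intro p q hpq
      obtain ⟨hle, r, hr, hr'⟩ := SetLike.lt_iff_le_and_exists.1 hpq
      refine SetLike.lt_iff_le_and_exists.2 ⟨Ideal.comap_mono hle, e r, ?_, ?_⟩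
      · simpa [Ideal.mem_comap] using hr
      · simpa [Ideal.mem_comap] using hr'
    refine hasTriple_poly (hlt h12) (hlt h23) (h := Polynomial.C ((hu.unit⁻¹ : (MvPolynomial (Fin n) k)ˣ) : MvPolynomial (Fin n) k) * e f) ?_ ?_
    · rw [Polynomial.Monic, Polynomial.leadingCoeff_mul, Polynomial.leadingCoeff_C]
      exact hu.val_inv_mul
    · apply Ideal.mul_mem_left
      simpa [Ideal.mem_comap] using hf1

end Triple


section Unmixed

lemma exchange {R : Type*} [CommRing R] [IsDomain R] {f1 f2 w : R} {p : Ideal R}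
    (hf : RegPair f1 f2) (hf2 : f2 ≠ 0)
    (ht : HasTriple p) (hw : ∀ g ∈ p, g * w ∈ Ideal.span {f1, f2}) : w ∈ Ideal.span {f1, f2} := by
  obtain ⟨g1, hg1, g2, hg2, g3, hg3, h0, h12, h3⟩ := ht
  simp only [Ideal.mem_span_pair] at hw h3 ⊢
  obtain ⟨a1, b1, e1⟩ := hw _ hg1
  obtain ⟨a2, b2, e2⟩ := hw _ hg2
  obtain ⟨a3, b3, e3⟩ := hw _ hg3
  obtain ⟨c12, m1, n1⟩ := hf (g2 * a1 - g1 * a2) (g1 * b2 - g2 * b1)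
    (by linear_combination g2 * e1 - g1 * e2)
  obtain ⟨c13, m2, n2⟩ := hf (g3 * a1 - g1 * a3) (g1 * b3 - g3 * b1)
    (by linear_combination g3 * e1 - g1 * e3)
  obtain ⟨c23, m3, n3⟩ := hf (g3 * a2 - g2 * a3) (g2 * b3 - g3 * b2)
    (by linear_combination g3 * e2 - g2 * e3)
  have hc : g3 * c12 - g2 * c13 + g1 * c23 = 0 := by
    apply mul_left_cancel₀ hf2
    linear_combination -g3 * m1 + g2 * m2 - g1 * m3
  obtain ⟨s, t, hst⟩ := h3 c12 ⟨-c23, c13, by linear_combination -hc⟩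
  -- `c12 = s g1 + t g2`
  obtain ⟨A, -, hA⟩ := h12 (a2 + f2 * s) (a1 - f2 * t) (by linear_combination -m1 + f2 * hst)
  obtain ⟨B, -, hB⟩ := h12 (b2 - f1 * s) (b1 + f1 * t) (by linear_combination n1 - f1 * hst)
  refine ⟨A, B, ?_⟩
  apply mul_left_cancel₀ h0
  linear_combination e1 - f1 * hA - f2 * hB

variable {k : Type} [Field k] {N : ℕ}

lemma idealHeight_le_height {R : Type} [CommRing R] {J p : Ideal R} (hp : p.IsPrime) (h : J ≤ p) :
    idealHeight J ≤ Order.height (⟨p, hp⟩ : {q : Ideal R // q.IsPrime}) :=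
  iInf₂_le (α := ℕ∞) (⟨p, hp⟩ : {q : Ideal R // q.IsPrime}) h

lemma idealHeight_prime {R : Type} [CommRing R] {p : Ideal R} (hp : p.IsPrime) :
    idealHeight p = Order.height (⟨p, hp⟩ : {q : Ideal R // q.IsPrime}) := by
  apply le_antisymm (idealHeight_le_height hp le_rfl)
  exact le_iInf₂ (α := ℕ∞) fun q hq => Order.height_mono hq

lemma hasTriple_of_height {p : Ideal (MvPolynomial (Fin N) k)} (hp : p.IsPrime)
    (h : 3 ≤ Order.height (⟨p, hp⟩ : {q : Ideal (MvPolynomial (Fin N) k) // q.IsPrime})) :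
    HasTriple p := by
  obtain ⟨s, hs, hl⟩ := Order.exists_series_of_le_height (n := 3) _ h
  obtain ⟨l, f, hf⟩ := s
  dsimp only at hl
  subst hl
  have h3 : (f 3).1 = p := congrArg Subtype.val hs
  subst h3
  exact hasTriple_mvPoly (f 1).2 (f 2).2 (f 3).2 (hf 0) (hf 1) (hf 2)

lemma height_pair {a b : MvPolynomial (Fin N) k} (h : idealHeight (Ideal.span {a, b}) = 2) :
    a ≠ 0 ∧ b ≠ 0 ∧ RegPair a b := by
  -- any prime element does not divide both
  have key : ∀ g : MvPolynomial (Fin N) k, Prime g → ¬ (g ∣ a ∧ g ∣ b) := by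
    rintro g hg ⟨ha, hb⟩
    have hp : (Ideal.span {g}).IsPrime := (Ideal.span_singleton_prime hg.ne_zero).2 hg
    have h1 : Ideal.span {a, b} ≤ Ideal.span {g} := by
      rw [Ideal.span_le]
      rintro r (rfl | rfl)
      · exact Ideal.mem_span_singleton.2 ha
      · exact Ideal.mem_span_singleton.2 hb
    have h2 := idealHeight_le_height hp h1
    rw [h] at h2
    have h3 : 1 < Order.height (⟨_, hp⟩ : {q : Ideal (MvPolynomial (Fin N) k) // q.IsPrime}) :=
      lt_of_lt_of_le (by norm_num) h2
    obtain ⟨⟨y, hy⟩, ⟨w, hw⟩, h4, h5⟩ := Order.one_lt_height_iff.1 h3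
    have h4 : w < y := h4
    have h5 : y < Ideal.span {g} := h5
    have hne : y ≠ ⊥ := fun h0 => by rw [h0] at h4; exact not_lt_bot h4
    obtain ⟨c, hc, hcp⟩ := hy.exists_mem_prime_of_ne_bot hne
    have hd : g ∣ c := Ideal.mem_span_singleton.1 (h5.le hc)
    have hass := (hg.dvd_prime_iff_associated hcp).1 hd
    apply h5.not_ge
    rw [Ideal.span_singleton_le_iff_mem]
    exact Ideal.mem_of_dvd _ hass.symm.dvd hc
  have hex : ∀ a b : MvPolynomial (Fin N) k, (∀ g : MvPolynomial (Fin N) k, Prime g → ¬ (g ∣ a ∧ g ∣ b)) →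
      idealHeight (Ideal.span {a, b}) = 2 → a ≠ 0 := by
    rintro a b key h rfl
    by_cases hb : b = 0
    · subst hb
      have h1 := idealHeight_le_height (R := MvPolynomial (Fin N) k) (J := Ideal.span {0, 0})
        Ideal.isPrime_bot (by simp)
      rw [h] at h1
      have h3 : 1 < Order.height (⟨_, Ideal.isPrime_bot⟩ : {q : Ideal (MvPolynomial (Fin N) k) // q.IsPrime}) :=
        lt_of_lt_of_le (by norm_num) h1
      obtain ⟨⟨y, hy⟩, w, h4, h5⟩ := Order.one_lt_height_iff.1 h3
      have h5 : y < ⊥ := h5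
      exact not_lt_bot h5
    · by_cases hu : IsUnit b
      · have : Ideal.span {0, b} = ⊤ := Ideal.eq_top_of_isUnit_mem _ (Ideal.subset_span (by simp)) hu
        rw [this, idealHeight] at h
        have h6 : (2 : ℕ∞) = ⊤ := by
          rw [← h]
          simp only [iInf_eq_top]
          intro p hp
          exact absurd (top_le_iff.1 hp) p.2.ne_top
        exact absurd h6 (by decide)
      · obtain ⟨g, hg, hgb⟩ := WfDvdMonoid.exists_irreducible_factor hu hb
        exact key g hg.prime ⟨dvd_zero _, hgb⟩
  have ha : a ≠ 0 := hex a b key h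
  have hb : b ≠ 0 := hex b a (fun g hg h => key g hg h.symm) (by rwa [Set.pair_comm])
  refine ⟨ha, hb, fun r s hrs => ?_⟩
  have hrel : IsRelPrime a b := by
    rw [UniqueFactorizationMonoid.isRelPrime_iff_no_prime_factors ha]
    intro d h1 h2 h3
    exact key d h3 ⟨h1, h2⟩
  obtain ⟨t, ht⟩ : a ∣ s := hrel.dvd_of_dvd_mul_left ⟨r, hrs.symm⟩
  refine ⟨t, ?_, ht⟩
  apply mul_left_cancel₀ ha
  rw [hrs, ht]; ring

lemma exists_assoc {R : Type} [CommRing R] [IsNoetherianRing R] {J : Ideal R} {g : R} (hg : g ∉ J) :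
    ∃ p : Ideal R, p.IsPrime ∧ (∀ r, r * g ∈ J → r ∈ p) ∧ ∃ w, ∀ r, r ∈ p ↔ r * w ∈ J := by
  obtain ⟨p, hp, hle⟩ := exists_le_isAssociatedPrime_of_isNoetherianRing R (M := R ⧸ J)
    (Ideal.Quotient.mk J g) (by rwa [Ne, Ideal.Quotient.eq_zero_iff_mem])
  rw [isAssociatedPrime_iff] at hp
  obtain ⟨hpp, y, hy⟩ := hp
  obtain ⟨w, rfl⟩ := Ideal.Quotient.mk_surjective y
  have hm : ∀ r w : R, r ∈ (⊥ : Submodule R (R ⧸ J)).colon {Ideal.Quotient.mk J w} ↔ r * w ∈ J := by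
    intro r w
    rw [Submodule.mem_colon_singleton, Submodule.mem_bot, ← Ideal.Quotient.eq_zero_iff_mem]
    rfl
  refine ⟨p, hpp, fun r hr => hle ((hm r g).2 hr), w, fun r => ?_⟩
  rw [hy, hm]

lemma mem_colon_span {R : Type} [CommRing R] {J : Ideal R} {r s : R} :
    r ∈ Submodule.colon J (Ideal.span {s} : Set R) ↔ r * s ∈ J := by
  rw [Submodule.mem_colon]
  constructor
  · intro h
    exact h s (Ideal.mem_span_singleton_self s)
  · intro h t ht
    obtain ⟨c, rfl⟩ := Ideal.mem_span_singleton.1 ht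
    rw [smul_eq_mul, ← mul_assoc]
    exact J.mul_mem_right _ h

lemma mem_primaryComponent {R : Type} [CommRing R] {J p : Ideal R} (hp : p.IsPrime) {g : R} :
    g ∈ primaryComponent J p ↔ ∃ s, s ∉ p ∧ g * s ∈ J := by
  constructor
  · intro hg
    have key : primaryComponent J p ≤
        { carrier := {g | ∃ s, s ∉ p ∧ g * s ∈ J}
          zero_mem' := ⟨1, hp.one_notMem, by simp⟩
          add_mem' := by
            rintro a b ⟨s, hs, h1⟩ ⟨t, ht, h2⟩
            refine ⟨s * t, fun h => (hp.mem_or_mem h).elim hs ht, ?_⟩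
            have : (a + b) * (s * t) = t * (a * s) + s * (b * t) := by ring
            rw [this]
            exact J.add_mem (J.mul_mem_left _ h1) (J.mul_mem_left _ h2)
          smul_mem' := by
            rintro c a ⟨s, hs, h1⟩
            refine ⟨s, hs, ?_⟩
            rw [smul_eq_mul, mul_assoc]
            exact J.mul_mem_left _ h1 } := by
      refine iSup₂_le fun s hs r hr => ⟨s, hs, mem_colon_span.1 hr⟩
    exact key hg
  · rintro ⟨s, hs, h⟩
    exact (le_iSup₂ (f := fun (s : R) (_ : s ∉ p) => Submodule.colon J (Ideal.span {s} : Set R)) s hs)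
      (mem_colon_span.2 h)

lemma le_unmixedPart {R : Type} [CommRing R] (J : Ideal R) : J ≤ unmixedPart J := by
  refine le_iInf₂ fun p hp g hg => ?_
  exact (mem_primaryComponent hp.1).2 ⟨1, hp.1.one_notMem, by simpa using hg⟩

/-- Unmixedness of the complete intersection. -/
lemma unmixed_mul {f1 f2 f3 : MvPolynomial (Fin N) k}
    (hI : idealHeight (Ideal.span {f1, f2, f3}) = 2) (hJ : idealHeight (Ideal.span {f1, f2}) = 2)
    {t g : MvPolynomial (Fin N) k} (ht : t * f3 ∈ Ideal.span {f1, f2})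
    (hg : g ∈ unmixedPart (Ideal.span {f1, f2, f3})) : t * g ∈ Ideal.span {f1, f2} := by
  by_contra hcon
  obtain ⟨hf1, hf2, hreg⟩ := height_pair hJ
  obtain ⟨p, hp, hle, w, hw⟩ := exists_assoc hcon
  have hJp : Ideal.span {f1, f2} ≤ p := fun r hr => (hw r).2 (Ideal.mul_mem_right _ _ hr)
  have hJI : ∀ r ∈ Ideal.span {f1, f2, f3}, r * t ∈ Ideal.span {f1, f2} := by
    intro r hr
    have : Ideal.span {f1, f2, f3} ≤ Submodule.colon (Ideal.span {f1, f2}) (Ideal.span {t} : Set _) := by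
      rw [Ideal.span_le]
      rintro r (rfl | rfl | rfl)
      · exact mem_colon_span.2 (Ideal.mul_mem_right _ _ (Ideal.subset_span (by simp)))
      · exact mem_colon_span.2 (Ideal.mul_mem_right _ _ (Ideal.subset_span (by simp)))
      · exact mem_colon_span.2 (by rwa [mul_comm])
    exact mem_colon_span.1 (this hr)
  have hIp : Ideal.span {f1, f2, f3} ≤ p := by
    intro r hr
    apply hle
    rw [← mul_assoc]
    exact Ideal.mul_mem_right _ _ (hJI r hr)
  have h2 := idealHeight_le_height hp hJp
  rw [hJ] at h2
  have hne : idealHeight p ≠ 2 := by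
    intro h
    have := (iInf₂_le (f := fun (p : Ideal (MvPolynomial (Fin N) k)) (_ : p ∈ {p : Ideal _ | p.IsPrime ∧
      Ideal.span {f1, f2, f3} ≤ p ∧ idealHeight p = idealHeight (Ideal.span {f1, f2, f3})}) =>
      primaryComponent (Ideal.span {f1, f2, f3}) p) p ⟨hp, hIp, by rw [h, hI]⟩) hg
    obtain ⟨s, hs, hgs⟩ := (mem_primaryComponent hp).1 this
    apply hs
    apply hle
    have := hJI _ hgs
    have e : s * (t * g) = g * s * t := by ring
    rwa [e]
  rw [idealHeight_prime hp] at hne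
  have h3 : 3 ≤ Order.height (⟨p, hp⟩ : {q : Ideal (MvPolynomial (Fin N) k) // q.IsPrime}) := by
    have := lt_of_le_of_ne h2 (Ne.symm hne)
    exact Order.add_one_le_of_lt this
  have := exchange hreg hf2 (hasTriple_of_height hp h3) (fun r hr => (hw r).1 hr)
  apply hp.ne_top
  rw [Ideal.eq_top_iff_one, hw, one_mul]
  exact this

end Unmixed


section Helpers
variable {R : Type} [CommRing R]

lemma mem_sup_span {X : Ideal R} {w r : R} : r ∈ X ⊔ Ideal.span {w} ↔ ∃ c, r - c * w ∈ X := by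
  rw [Submodule.mem_sup]
  constructor
  · rintro ⟨a, ha, b, hb, rfl⟩
    obtain ⟨c, rfl⟩ := Ideal.mem_span_singleton'.1 hb
    exact ⟨c, by simpa using ha⟩
  · rintro ⟨c, hc⟩
    exact ⟨_, hc, c * w, Ideal.mul_mem_left _ _ (Ideal.mem_span_singleton_self w), by ring⟩

lemma mem_sup_mul {X A : Ideal R} {z r : R} :
    r ∈ X ⊔ Ideal.span {z} * A ↔ ∃ a ∈ A, r - z * a ∈ X := by
  rw [Submodule.mem_sup]
  constructor
  · rintro ⟨a, ha, b, hb, rfl⟩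
    obtain ⟨c, hc, rfl⟩ := Ideal.mem_span_singleton_mul.1 hb
    exact ⟨c, hc, by simpa using ha⟩
  · rintro ⟨c, hc, h⟩
    exact ⟨_, h, z * c, Ideal.mem_span_singleton_mul.2 ⟨c, hc, rfl⟩, by ring⟩

lemma mem_sup_right' {X Y : Ideal R} {r : R} : r ∈ X ⊔ Y ↔ ∃ y ∈ Y, r - y ∈ X := by
  rw [Submodule.mem_sup]
  constructor
  · rintro ⟨a, ha, b, hb, rfl⟩
    exact ⟨b, hb, by simpa using ha⟩
  · rintro ⟨y, hy, h⟩
    exact ⟨_, h, y, hy, by ring⟩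

lemma mem_pair_iff {z q r : R} : r ∈ Ideal.span {z, q} ↔ ∃ a b, r = a * z + b * q := by
  rw [Ideal.mem_span_pair]
  simp only [eq_comm]

/-- case (a): `z ∈ A`, `q ∉ A`. -/
lemma inf_case_a {A : Ideal R} {z y q : R} (hA : A.IsPrime) (e : A = Ideal.span {z, y})
    (hq : q ∉ A) : A ⊓ Ideal.span {z, q} = Ideal.span {z, y * q} := by
  have hz : z ∈ A := by rw [e]; exact Ideal.subset_span (by simp)
  have hy : y ∈ A := by rw [e]; exact Ideal.subset_span (by simp)
  apply le_antisymm
  · rintro r ⟨hr, hr'⟩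
    obtain ⟨a, b, rfl⟩ := mem_pair_iff.1 hr'
    have hb : b * q ∈ A := (Ideal.add_mem_iff_right _ (A.mul_mem_left _ hz)).1 hr
    have hb := (hA.mem_or_mem hb).resolve_right hq
    rw [e] at hb
    obtain ⟨c, d, rfl⟩ := mem_pair_iff.1 hb
    exact mem_pair_iff.2 ⟨a + c * q, d, by ring⟩
  · rw [Ideal.span_le]
    rintro r (rfl | rfl)
    · exact ⟨hz, Ideal.subset_span (by simp)⟩
    · exact ⟨A.mul_mem_right _ hy, Ideal.mul_mem_left _ _ (Ideal.subset_span (by simp))⟩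

/-- case (b): `z ∉ A`, `q ∈ A`. -/
lemma inf_case_b {A : Ideal R} {z q : R} (hA : A.IsPrime) (hz : z ∉ A) (hq : q ∈ A) :
    A ⊓ Ideal.span {z, q} = Ideal.span {q} ⊔ Ideal.span {z} * A := by
  apply le_antisymm
  · rintro r ⟨hr, hr'⟩
    obtain ⟨a, b, rfl⟩ := mem_pair_iff.1 hr'
    have hb : a * z ∈ A := (Ideal.add_mem_iff_left _ (A.mul_mem_left _ hq)).1 hr
    have hb := (hA.mem_or_mem hb).resolve_right hz
    exact mem_sup_mul.2 ⟨a, hb, Ideal.mem_span_singleton'.2 ⟨b, by ring⟩⟩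
  · apply sup_le
    · rw [Ideal.span_singleton_le_iff_mem]
      exact ⟨hq, Ideal.subset_span (by simp)⟩
    · apply le_inf Ideal.mul_le_right
      refine Ideal.mul_le_left.trans ?_
      rw [Ideal.span_singleton_le_iff_mem]
      exact Ideal.subset_span (by simp)

/-- case (c): `z ∉ A`, `q ∉ A + (z)`. -/
lemma inf_case_c {A : Ideal R} {z q : R} (hA : A.IsPrime) (hAz : (A ⊔ Ideal.span {z}).IsPrime)
    (hz : z ∉ A) (hq : q ∉ A ⊔ Ideal.span {z}) :
    A ⊓ Ideal.span {z, q} = Ideal.span {z} * A ⊔ Ideal.span {q} * A := by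
  apply le_antisymm
  · rintro r ⟨hr, hr'⟩
    obtain ⟨a, b, rfl⟩ := mem_pair_iff.1 hr'
    have hb : b * q ∈ A ⊔ Ideal.span {z} :=
      mem_sup_span.2 ⟨-a, by
        have : b * q - -a * z = a * z + b * q := by ring
        rw [this]; exact hr⟩
    have hb := (hAz.mem_or_mem hb).resolve_right hq
    obtain ⟨c, hc⟩ := mem_sup_span.1 hb
    have h1 : (a + c * q) * z ∈ A := by
      have : (a + c * q) * z = (a * z + b * q) - (b - c * z) * q := by ring
      rw [this]
      exact A.sub_mem hr (A.mul_mem_right _ hc)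
    have h1 := (hA.mem_or_mem h1).resolve_right hz
    refine mem_sup_mul.2 ⟨_, hc, Ideal.mem_span_singleton_mul.2 ⟨_, h1, by ring⟩⟩
  · have h1 : ∀ w ∈ Ideal.span {z, q}, Ideal.span {w} * A ≤ A ⊓ Ideal.span {z, q} := by
      intro w hw
      apply le_inf Ideal.mul_le_right
      refine Ideal.mul_le_left.trans ?_
      rwa [Ideal.span_singleton_le_iff_mem]
    exact sup_le (h1 z (Ideal.subset_span (by simp))) (h1 q (Ideal.subset_span (by simp)))

lemma span_pair_change {z q c : R} : Ideal.span {z, q - c * z} = Ideal.span {z, q} := by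
  ext r
  simp only [mem_pair_iff]
  constructor
  · rintro ⟨a, b, rfl⟩; exact ⟨a - b * c, b, by ring⟩
  · rintro ⟨a, b, rfl⟩; exact ⟨a + b * c, b, by ring⟩

end Helpers

section PDK
variable {k : Type} [Field k] {N : ℕ} {A B : Ideal (MvPolynomial (Fin N) k)}
  {z q : MvPolynomial (Fin N) k}

/-- If `C ≤ A`. -/
lemma pdK_a1 (hB : IsLin B) (hB2 : PDLE B 2) (hz : z.IsHomogeneous 1)
    : PDLE (B ⊓ Ideal.span {z, q}) 4 := by
  apply pdle_inf (hB2.mono (by norm_num)) ((pdle_lin_pair hz).mono (by norm_num))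
  exact (hB.pdle_sup_pair hB2 hz).mono (by norm_num)

lemma pdK_b (hA : IsLin A) (hB : IsLin B) (hA2 : PDLE A 2) (hB2 : PDLE B 2)
    (hAB : PDLE (A ⊔ B) 4) (hz : z.IsHomogeneous 1) (hzA : z ∉ A) (hqA : q ∈ A) :
    PDLE (B ⊓ (A ⊓ Ideal.span {z, q})) 4 := by
  have hBz : (B ⊔ Ideal.span {z}).IsPrime := (hB.sup (isLin_singleton hz)).isPrime
  rw [inf_case_b hA.isPrime hzA hqA]
  have hD : PDLE (Ideal.span {q} ⊔ Ideal.span {z} * A) 2 := by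
    refine pdle_mid (Y := A) (Z := Ideal.span {z, q}) z ?_ ?_ hA2 (pdle_lin_pair hz)
    · intro r
      rw [mem_sup_mul]
      constructor
      · intro hr
        exact ⟨r, hr, by simp [mul_comm]⟩
      · rintro ⟨a, ha, h⟩
        have h1 : (r - a) * z ∈ A := by
          have : (r - a) * z = r * z - z * a := by ring
          rw [this]
          exact (Ideal.span_singleton_le_iff_mem _).2 hqA h
        have := (hA.isPrime.mem_or_mem h1).resolve_right hzA
        simpa using A.add_mem this ha
    · rw [sup_assoc, sup_eq_right.2 (Ideal.mul_le_left : Ideal.span {z} * A ≤ _), sup_comm,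
        span_pair_sup]
  refine pdle_inf (hB2.mono (by norm_num)) (hD.mono (by norm_num)) ?_
  have hmem : ∀ r, r ∈ B ⊔ (Ideal.span {q} ⊔ Ideal.span {z} * A) ↔
      ∃ a ∈ A, ∃ c, r - z * a - c * q ∈ B := by
    intro r
    rw [← sup_assoc, mem_sup_mul]
    simp only [mem_sup_span]
  by_cases hzB : z ∈ B
  · have : B ⊔ (Ideal.span {q} ⊔ Ideal.span {z} * A) = B ⊔ Ideal.span {q} := by
      rw [← sup_assoc, sup_right_comm]
      congr 1
      rw [sup_eq_left]
      exact Ideal.mul_le_left.trans ((Ideal.span_singleton_le_iff_mem _).2 hzB)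
    rw [this]
    exact (hB.pdle_sup hB2 q).mono (by norm_num)
  have hZ : B ⊔ (Ideal.span {q} ⊔ Ideal.span {z} * A) ⊔ Ideal.span {z} = B ⊔ Ideal.span {z, q} := by
    rw [sup_assoc, sup_assoc, sup_eq_right.2 (Ideal.mul_le_left : Ideal.span {z} * A ≤ _),
      sup_comm (Ideal.span {q}), span_pair_sup]
  have hZ4 : PDLE (B ⊔ Ideal.span {z, q}) 4 := hB.pdle_sup_pair hB2 hz
  by_cases hqB : q ∈ B ⊔ Ideal.span {z}
  · obtain ⟨c0, hc0⟩ := mem_sup_span.1 hqB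
    refine pdle_mid (Y := A ⊔ B ⊔ Ideal.span {c0}) z ?_ hZ
      ((hA.sup hB).pdle_sup hAB c0) (hZ4.mono (by norm_num))
    intro r
    rw [hmem, mem_sup_span]
    constructor
    · rintro ⟨c, hc⟩
      obtain ⟨b, hb, ha⟩ := mem_sup_right'.1 hc
      refine ⟨_, ha, c, ?_⟩
      have : r * z - z * (r - c * c0 - b) - c * q = b * z - c * (q - c0 * z) := by ring
      rw [this]
      exact B.sub_mem (B.mul_mem_right _ hb) (B.mul_mem_left _ hc0)
    · rintro ⟨a, ha, c, h⟩
      refine ⟨c, mem_sup_right'.2 ⟨r - c * c0 - a, ?_, by simpa using ha⟩⟩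
      have h1 : (r - c * c0 - a) * z ∈ B := by
        have : (r - c * c0 - a) * z = (r * z - z * a - c * q) + c * (q - c0 * z) := by ring
        rw [this]
        exact B.add_mem h (B.mul_mem_left _ hc0)
      exact (hB.isPrime.mem_or_mem h1).resolve_right hzB
  · refine pdle_mid (Y := A ⊔ B) z ?_ hZ (hAB.mono (by norm_num)) (hZ4.mono (by norm_num))
    intro r
    rw [hmem]
    constructor
    · intro hc
      obtain ⟨b, hb, ha⟩ := mem_sup_right'.1 hc
      refine ⟨_, ha, 0, ?_⟩
      have : r * z - z * (r - b) - 0 * q = b * z := by ring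
      rw [this]
      exact B.mul_mem_right _ hb
    · rintro ⟨a, ha, c, h⟩
      have h1 : c * q ∈ B ⊔ Ideal.span {z} := mem_sup_span.2 ⟨r - a, by
        have := B.neg_mem h
        convert this using 1; ring⟩
      obtain ⟨d, hd⟩ := mem_sup_span.1 ((hBz.mem_or_mem h1).resolve_right hqB)
      have h2 : (r - a - q * d) * z ∈ B := by
        have : (r - a - q * d) * z = (r * z - z * a - c * q) + q * (c - d * z) := by ring
        rw [this]
        exact B.add_mem h (B.mul_mem_left _ hd)
      have h3 := (hB.isPrime.mem_or_mem h2).resolve_right hzB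
      refine mem_sup_right'.2 ⟨_, h3, ?_⟩
      have : r - (r - a - q * d) = a + q * d := by ring
      rw [this]
      exact A.add_mem ha (A.mul_mem_right _ hqA)

lemma pdK_c (hA : IsLin A) (hB : IsLin B) (hA2 : PDLE A 2) (hB2 : PDLE B 2)
    (hAB : PDLE (A ⊔ B) 4) (hz : z.IsHomogeneous 1) (hzA : z ∉ A) (hqA : q ∉ A ⊔ Ideal.span {z})
    (hzB : z ∉ B) (hqB : q ∉ B ⊔ Ideal.span {z}) :
    PDLE (B ⊓ (A ⊓ Ideal.span {z, q})) 4 := by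
  have hBz : (B ⊔ Ideal.span {z}).IsPrime := (hB.sup (isLin_singleton hz)).isPrime
  have hAz : (A ⊔ Ideal.span {z}).IsPrime := (hA.sup (isLin_singleton hz)).isPrime
  have hD : PDLE (A ⊓ Ideal.span {z, q}) 4 := by
    apply pdle_inf (hA2.mono (by norm_num)) ((pdle_lin_pair hz).mono (by norm_num))
    exact (hA.pdle_sup_pair hA2 hz).mono (by norm_num)
  refine pdle_inf (hB2.mono (by norm_num)) hD ?_
  rw [inf_case_c hA.isPrime hAz hzA hqA, ← sup_assoc]
  have hX1 : PDLE (B ⊔ Ideal.span {z} ⊔ Ideal.span {q} * A) 5 := by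
    refine pdle_mid (Y := A ⊔ B ⊔ Ideal.span {z}) (Z := B ⊔ Ideal.span {z, q}) q ?_ ?_
      ((hA.sup hB).pdle_sup hAB z) ((hB.pdle_sup_pair hB2 hz).mono (by norm_num))
    · intro r
      rw [sup_assoc A, mem_sup_right', mem_sup_mul]
      constructor
      · rintro ⟨b, hb, ha⟩
        refine ⟨_, ha, ?_⟩
        have : r * q - q * (r - b) = b * q := by ring
        rw [this]
        exact Ideal.mul_mem_right _ _ hb
      · rintro ⟨a, ha, h⟩
        have h1 : (r - a) * q ∈ B ⊔ Ideal.span {z} := by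
          convert h using 1; ring
        exact ⟨_, (hBz.mem_or_mem h1).resolve_right hqB, by simpa using ha⟩
    · rw [sup_assoc, sup_eq_right.2 (Ideal.mul_le_left : Ideal.span {q} * A ≤ _), sup_assoc,
        ← span_pair_sup]
  have hZ : B ⊔ Ideal.span {z} * A ⊔ Ideal.span {q} * A ⊔ Ideal.span {z} =
      B ⊔ Ideal.span {z} ⊔ Ideal.span {q} * A := by
    rw [sup_right_comm, sup_assoc B, sup_eq_right.2 (Ideal.mul_le_left : Ideal.span {z} * A ≤ _)]
  have hmem : ∀ r, r ∈ B ⊔ Ideal.span {z} * A ⊔ Ideal.span {q} * A ↔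
      ∃ a' ∈ A, ∃ a ∈ A, r - q * a' - z * a ∈ B := by
    intro r
    simp only [mem_sup_mul]
  have hback : ∀ r ∈ A ⊔ B, r * z ∈ B ⊔ Ideal.span {z} * A ⊔ Ideal.span {q} * A := by
    intro r hr
    obtain ⟨b, hb, ha⟩ := mem_sup_right'.1 hr
    refine (hmem _).2 ⟨0, A.zero_mem, _, ha, ?_⟩
    have : r * z - q * 0 - z * (r - b) = b * z := by ring
    rw [this]
    exact B.mul_mem_right _ hb
  by_cases hzAB : z ∈ A ⊔ B
  · refine pdle_mid (Y := A ⊔ B ⊔ Ideal.span {q}) z ?_ hZ ((hA.sup hB).pdle_sup hAB q) hX1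
    intro r
    constructor
    · intro hr
      obtain ⟨c, hc⟩ := mem_sup_span.1 hr
      have h1 : q * z ∈ B ⊔ Ideal.span {z} * A ⊔ Ideal.span {q} * A := by
        obtain ⟨b, hb, ha⟩ := mem_sup_right'.1 hzAB
        refine (hmem _).2 ⟨_, ha, 0, A.zero_mem, ?_⟩
        have : q * z - q * (z - b) - z * 0 = b * q := by ring
        rw [this]
        exact B.mul_mem_right _ hb
      have : r * z = (r - c * q) * z + c * (q * z) := by ring
      rw [this]
      exact Ideal.add_mem _ (hback _ hc) (Ideal.mul_mem_left _ _ h1)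
    · intro hr
      obtain ⟨a', ha', a, ha, h⟩ := (hmem _).1 hr
      have h1 : a' * q ∈ B ⊔ Ideal.span {z} := mem_sup_span.2 ⟨r - a, by
        have := B.neg_mem h
        convert this using 1; ring⟩
      obtain ⟨c, hc⟩ := mem_sup_span.1 ((hBz.mem_or_mem h1).resolve_right hqB)
      have h2 : (r - a - c * q) * z ∈ B := by
        have : (r - a - c * q) * z = (r * z - q * a' - z * a) + q * (a' - c * z) := by ring
        rw [this]
        exact B.add_mem h (B.mul_mem_left _ hc)
      have h3 := (hB.isPrime.mem_or_mem h2).resolve_right hzB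
      refine mem_sup_span.2 ⟨c, mem_sup_right'.2 ⟨_, h3, ?_⟩⟩
      convert ha using 1; ring
  · refine pdle_mid (Y := A ⊔ B) z ?_ hZ (hAB.mono (by norm_num)) hX1
    intro r
    refine ⟨hback r, fun hr => ?_⟩
    obtain ⟨a', ha', a, ha, h⟩ := (hmem _).1 hr
    have h1 : r * z ∈ A ⊔ B := by
      refine mem_sup_right'.2 ⟨_, h, ?_⟩
      have : r * z - (r * z - q * a' - z * a) = q * a' + z * a := by ring
      rw [this]
      exact A.add_mem (A.mul_mem_left _ ha') (A.mul_mem_left _ ha)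
    exact ((hA.sup hB).isPrime.mem_or_mem h1).resolve_right hzAB

/-- A prime of height two containing the linear form `z` is `(z, y)`. -/
lemma exists_pair (hA : A.IsPrime) (hAh : idealHeight A = 2) (hz : z.IsHomogeneous 1) (hz0 : z ≠ 0)
    (hzA : z ∈ A) : ∃ y, A = Ideal.span {z, y} := by
  have hZ : IsLin (Ideal.span {z}) := isLin_singleton hz
  have hZp := hZ.isPrime
  have := hZ.ufd
  rw [idealHeight_prime hA] at hAh
  let S := {p : Ideal (MvPolynomial (Fin N) k) // p.IsPrime}
  let a : S := ⟨A, hA⟩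
  let b : S := ⟨Ideal.span {z}, hZp⟩
  let o : S := ⟨⊥, Ideal.isPrime_bot⟩
  have hob : o < b := by
    change (⊥ : Ideal _) < Ideal.span {z}
    rw [bot_lt_iff_ne_bot, Ne, Ideal.span_singleton_eq_bot]
    exact hz0
  have hle : Ideal.span {z} ≤ A := (Ideal.span_singleton_le_iff_mem _).2 hzA
  have hmap : Ideal.comap (Ideal.Quotient.mk (Ideal.span {z}))
      (A.map (Ideal.Quotient.mk (Ideal.span {z}))) = A := by
    rw [Ideal.comap_map_of_surjective' _ Ideal.Quotient.mk_surjective, Ideal.mk_ker]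
    exact sup_eq_left.2 hle
  have hprime : (A.map (Ideal.Quotient.mk (Ideal.span {z}))).IsPrime :=
    Ideal.map_isPrime_of_surjective Ideal.Quotient.mk_surjective (by rwa [Ideal.mk_ker])
  have hne : A.map (Ideal.Quotient.mk (Ideal.span {z})) ≠ ⊥ := by
    intro h
    rw [h] at hmap
    have hA' : A = Ideal.span {z} := by
      rw [← hmap, ← RingHom.ker_eq_comap_bot, Ideal.mk_ker]
    obtain ⟨y, w, h1, h2⟩ := Order.one_lt_height_iff.1
      (show 1 < Order.height a by rw [hAh]; norm_num)
    have h2 : y.1 < A := h2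
    have h1 : w.1 < y.1 := h1
    have hyb : y.1 ≠ ⊥ := fun h0 => by rw [h0] at h1; exact not_lt_bot h1
    obtain ⟨c, hc, hcp⟩ := y.2.exists_mem_prime_of_ne_bot hyb
    have hzp : Prime z := (Ideal.span_singleton_prime hz0).1 hZp
    have hd : z ∣ c := by
      rw [← Ideal.mem_span_singleton, ← hA']; exact h2.le hc
    have hass := (hzp.dvd_prime_iff_associated hcp).1 hd
    apply h2.not_ge
    rw [hA', Ideal.span_singleton_le_iff_mem]
    exact Ideal.mem_of_dvd _ hass.symm.dvd hc
  obtain ⟨c, hc, hcp⟩ := hprime.exists_mem_prime_of_ne_bot hne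
  obtain ⟨y, rfl⟩ := Ideal.Quotient.mk_surjective c
  refine ⟨y, ?_⟩
  have hyA : y ∈ A := by rw [← hmap]; exact hc
  have hcomap : Ideal.comap (Ideal.Quotient.mk (Ideal.span {z}))
      (Ideal.span {Ideal.Quotient.mk (Ideal.span {z}) y}) = Ideal.span {z, y} := by
    rw [← Set.image_singleton, ← Ideal.map_span, Ideal.comap_map_of_surjective' _ Ideal.Quotient.mk_surjective,
      Ideal.mk_ker, sup_comm, ← span_pair_sup]
  have hpr : (Ideal.span {z, y}).IsPrime := by
    rw [← hcomap]
    have := (Ideal.span_singleton_prime hcp.ne_zero).2 hcp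
    infer_instance
  let d : S := ⟨_, hpr⟩
  have hbd : b < d := by
    change Ideal.span {z} < Ideal.span {z, y}
    refine SetLike.lt_iff_le_and_exists.2 ⟨Ideal.span_mono (by simp), y, Ideal.subset_span (by simp), ?_⟩
    intro h
    exact hcp.ne_zero (Ideal.Quotient.eq_zero_iff_mem.2 h)
  have hda : Ideal.span {z, y} ≤ A := by
    rw [Ideal.span_le]
    rintro r (rfl | rfl)
    · exact hzA
    · exact hyA
  by_contra hcon
  have hlt : d < a := lt_of_le_of_ne hda (fun h => hcon (congrArg Subtype.val h).symm)
  have h1 : 1 < Order.height d := Order.one_lt_height_iff.2 ⟨b, o, hob, hbd⟩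
  have h2 := Order.height_add_one_le hlt
  rw [hAh] at h2
  have h3 : (2 : ℕ∞) ≤ Order.height d := Order.add_one_le_of_lt h1
  have h4 : (2 : ℕ∞) + 1 ≤ 2 := (add_le_add_left h3 1).trans h2
  exact absurd h4 (by decide)

end PDK


section PDK2
variable {k : Type} [Field k] {N : ℕ} {A B : Ideal (MvPolynomial (Fin N) k)}
  {z q : MvPolynomial (Fin N) k}

lemma pdK_ab (hA : IsLin A) (hB : IsLin B) (hA2 : PDLE A 2) (hB2 : PDLE B 2)
    (hAh : idealHeight A = 2)
    (hAB : PDLE (A ⊔ B) 4) (hz : z.IsHomogeneous 1) (hz0 : z ≠ 0)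
    (h : z ∈ A ∨ q ∈ A ⊔ Ideal.span {z}) :
    PDLE (B ⊓ (A ⊓ Ideal.span {z, q})) 4 := by
  by_cases hzA : z ∈ A
  · by_cases hqA : q ∈ A
    · have : A ⊓ Ideal.span {z, q} = Ideal.span {z, q} := by
        rw [inf_eq_right, Ideal.span_le]
        rintro r (rfl | rfl)
        · exact hzA
        · exact hqA
      rw [this]
      exact pdK_a1 hB hB2 hz
    · obtain ⟨y, hy⟩ := exists_pair hA.isPrime hAh hz hz0 hzA
      rw [inf_case_a hA.isPrime hy hqA]
      exact pdK_a1 hB hB2 hz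
  · obtain ⟨c, hc⟩ := mem_sup_span.1 (h.resolve_left hzA)
    rw [← span_pair_change (c := c)]
    exact pdK_b hA hB hA2 hB2 hAB hz hzA hc

lemma pdK (hA : IsLin A) (hB : IsLin B) (hA2 : PDLE A 2) (hB2 : PDLE B 2)
    (hAh : idealHeight A = 2) (hBh : idealHeight B = 2)
    (hAB : PDLE (A ⊔ B) 4) (hz : z.IsHomogeneous 1) (hz0 : z ≠ 0) :
    PDLE (A ⊓ B ⊓ Ideal.span {z, q}) 4 := by
  by_cases h1 : z ∈ A ∨ q ∈ A ⊔ Ideal.span {z}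
  · have := pdK_ab hA hB hA2 hB2 hAh hAB hz hz0 h1
    rwa [inf_comm A, inf_assoc]
  by_cases h2 : z ∈ B ∨ q ∈ B ⊔ Ideal.span {z}
  · have := pdK_ab hB hA hB2 hA2 hBh (by rwa [sup_comm]) hz hz0 h2
    rwa [inf_assoc]
  push Not at h1 h2
  have := pdK_c hA hB hA2 hB2 hAB hz h1.1 h1.2 h2.1 h2.2
  rwa [inf_comm A, inf_assoc]

end PDK2


section Link
variable {R : Type} [CommRing R]

lemma mem_cl {J X : Ideal R} {t : R} :
    t ∈ Submodule.colon J (X : Set R) ↔ ∀ g ∈ X, t * g ∈ J := by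
  rw [Submodule.mem_colon]
  rfl

/-- Linkage data for a complete intersection `C` containing `J`. -/
def LinkElt (J C : Ideal R) (Δ : R) : Prop :=
  (∀ w, w * Δ ∈ J ↔ w ∈ C) ∧ ∀ t, (∀ c ∈ C, t * c ∈ J) → ∃ c, t - c * Δ ∈ J

lemma exists_link [IsDomain R] {f1 f2 c1 c2 : R} (hf : RegPair f1 f2) (hf1 : f1 ≠ 0)
    (hc : RegPair c1 c2) (hc1 : c1 ≠ 0) (h1 : f1 ∈ Ideal.span {c1, c2})
    (h2 : f2 ∈ Ideal.span {c1, c2}) :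
    ∃ Δ, LinkElt (Ideal.span {f1, f2}) (Ideal.span {c1, c2}) Δ := by
  obtain ⟨m11, m12, e1⟩ := mem_pair_iff.1 h1
  obtain ⟨m21, m22, e2⟩ := mem_pair_iff.1 h2
  refine ⟨m11 * m22 - m12 * m21, ?_, ?_⟩
  · intro w
    constructor
    · intro h
      obtain ⟨α, β, h⟩ := mem_pair_iff.1 h
      obtain ⟨t, ht1, ht2⟩ := hf (w * m22 - c1 * α) (w * m12 + c1 * β)
        (by linear_combination c1 * h + w * m22 * e1 - w * m12 * e2)
      -- `c1` divides `m22 * s` and `m12 * s` with `s = w - c2 * t`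
      have d2 : f2 * (w - c2 * t) = c1 * (m21 * (w - c2 * t) + c2 * (α + m21 * t)) := by
        linear_combination (w - c2 * t) * e2 + c2 * ht1 + c2 * t * e2
      have d1 : f1 * (w - c2 * t) = c1 * (m11 * (w - c2 * t) + c2 * (-β + m11 * t)) := by
        linear_combination (w - c2 * t) * e1 + c2 * ht2 + c2 * t * e1
      obtain ⟨r, hr1, hr2⟩ := hf (m21 * (w - c2 * t) + c2 * (α + m21 * t))
        (m11 * (w - c2 * t) + c2 * (-β + m11 * t)) (by
          apply mul_left_cancel₀ hc1
          linear_combination f2 * d1 - f1 * d2)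
      have : w - c2 * t = c1 * r := by
        apply mul_left_cancel₀ hf1
        linear_combination d1 + c1 * hr2
      exact mem_pair_iff.2 ⟨r, t, by linear_combination this⟩
    · intro h
      obtain ⟨a, b, rfl⟩ := mem_pair_iff.1 h
      refine mem_pair_iff.2 ⟨a * m22 - b * m21, b * m11 - a * m12, ?_⟩
      rw [e1, e2]; ring
  · intro t ht
    obtain ⟨a, b, h1⟩ := mem_pair_iff.1 (ht c1 (Ideal.subset_span (by simp)))
    obtain ⟨a', b', h2⟩ := mem_pair_iff.1 (ht c2 (Ideal.subset_span (by simp)))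
    obtain ⟨h, g1, g2⟩ := hf (c2 * a - c1 * a') (c1 * b' - c2 * b)
      (by linear_combination c1 * h2 - c2 * h1)
    obtain ⟨r, -, hr⟩ := hc (a' + h * m21) (a - h * m22) (by linear_combination -g1 - h * e2)
    obtain ⟨r', -, hr'⟩ := hc (b' - h * m11) (b + h * m12) (by linear_combination g2 + h * e1)
    refine ⟨h, mem_pair_iff.2 ⟨r, r', ?_⟩⟩
    apply mul_left_cancel₀ hc1
    linear_combination h1 + f1 * hr + f2 * hr' + h * m22 * e1 - h * m12 * e2

/-- The extension property: every map `D → R/J` killing `J` is a multiplication. -/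
def ExtProp (J D : Ideal R) : Prop :=
  ∀ σ : R → R ⧸ J,
    (∀ α β, ∀ a ∈ D, ∀ b ∈ D, σ (α * a + β * b) =
      Ideal.Quotient.mk J α * σ a + Ideal.Quotient.mk J β * σ b) →
    (∀ a ∈ J, σ a = 0) → ∃ w : R, ∀ d ∈ D, σ d = Ideal.Quotient.mk J (w * d)

lemma extProp_pair [IsDomain R] {f1 f2 d1 d2 : R} (hf : RegPair f1 f2) (hf1 : f1 ≠ 0) (hf2 : f2 ≠ 0)
    (hd : RegPair d1 d2) (h1 : f1 ∈ Ideal.span {d1, d2})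
    (h2 : f2 ∈ Ideal.span {d1, d2}) :
    ExtProp (Ideal.span {f1, f2}) (Ideal.span {d1, d2}) := by
  intro σ hσ hσ0
  obtain ⟨m11, m12, e1⟩ := mem_pair_iff.1 h1
  obtain ⟨m21, m22, e2⟩ := mem_pair_iff.1 h2
  have hD1 : d1 ∈ Ideal.span {d1, d2} := Ideal.subset_span (by simp)
  have hD2 : d2 ∈ Ideal.span {d1, d2} := Ideal.subset_span (by simp)
  obtain ⟨s1, hs1⟩ := Ideal.Quotient.mk_surjective (σ d1)
  obtain ⟨s2, hs2⟩ := Ideal.Quotient.mk_surjective (σ d2)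
  have key : ∀ a b : R, a * d1 + b * d2 ∈ Ideal.span {f1, f2} →
      ∃ p r, a * s1 + b * s2 = p * f1 + r * f2 := by
    intro a b hab
    have := hσ0 _ hab
    rw [hσ a b d1 hD1 d2 hD2, ← hs1, ← hs2, ← map_mul, ← map_mul, ← map_add,
      Ideal.Quotient.eq_zero_iff_mem] at this
    exact mem_pair_iff.1 this
  obtain ⟨α, β, hab⟩ := key (-d2) d1 (by
    have : -d2 * d1 + d1 * d2 = 0 := by ring
    rw [this]; exact Ideal.zero_mem _)
  obtain ⟨p1, r1, k1⟩ := key m11 m12 (by rw [← e1]; exact Ideal.subset_span (by simp))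
  obtain ⟨p2, r2, k2⟩ := key m21 m22 (by rw [← e2]; exact Ideal.subset_span (by simp))
  obtain ⟨g1, hg1, -⟩ := hf (p2 * d1 - m22 * α) (s1 - r2 * d1 + m22 * β)
    (by linear_combination -d1 * k2 + m22 * hab - s1 * e2)
  obtain ⟨g2, hg2, -⟩ := hf (p2 * d2 + m21 * α) (s2 - r2 * d2 - m21 * β)
    (by linear_combination -d2 * k2 - m21 * hab - s2 * e2)
  obtain ⟨l1, -, hl1⟩ := hf (s1 - p1 * d1 + m12 * α) (r1 * d1 - m12 * β)
    (by linear_combination d1 * k1 - m12 * hab + s1 * e1)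
  obtain ⟨l2, -, hl2⟩ := hf (s2 - p1 * d2 - m11 * α) (r1 * d2 + m11 * β)
    (by linear_combination d2 * k1 + m11 * hab + s2 * e1)
  have hα : α = d1 * g2 - d2 * g1 := by
    apply mul_left_cancel₀ hf2
    linear_combination d1 * hg2 - d2 * hg1 + α * e2
  have hβ : β = d1 * l2 - d2 * l1 := by
    apply mul_left_cancel₀ hf1
    linear_combination d1 * hl2 - d2 * hl1 + β * e1
  obtain ⟨t, ht2, ht1⟩ := hd (s2 - f1 * g2 - f2 * l2) (s1 - f1 * g1 - f2 * l1)
    (by linear_combination hab + f1 * hα + f2 * hβ)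
  refine ⟨t, fun d hdd => ?_⟩
  obtain ⟨a, b, rfl⟩ := mem_pair_iff.1 hdd
  rw [hσ a b d1 hD1 d2 hD2, ← hs1, ← hs2, ← map_mul, ← map_mul, ← map_add, Ideal.Quotient.eq]
  refine mem_pair_iff.2 ⟨a * g1 + b * g2, a * l1 + b * l2, ?_⟩
  linear_combination a * ht1 + b * ht2

lemma extProp_inf {J A C : Ideal R} {w : R} (hA : A.IsPrime) (hJA : J ≤ A) (hJC : J ≤ C)
    (hwC : w ∈ C) (hwA : w ∉ A)
    (hC : ∀ c ∈ C, ∃ r, c - r * w ∈ A ⊓ C) (eA : ExtProp J A) (eC : ExtProp J C) :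
    ExtProp J (A ⊓ C) := by
  intro σ hσ hσ0
  have hwAD : ∀ a ∈ A, a * w ∈ A ⊓ C := fun a ha => ⟨A.mul_mem_right _ ha, C.mul_mem_left _ hwC⟩
  have hback : ∀ r, r * w ∈ A ⊓ C → r ∈ A := fun r hr => (hA.mem_or_mem hr.1).resolve_right hwA
  obtain ⟨W, hW⟩ := eA (fun a => σ (a * w)) (by
    intro α β a ha b hb
    rw [← hσ _ _ _ (hwAD a ha) _ (hwAD b hb)]
    congr 1; ring) (fun a ha => hσ0 _ (J.mul_mem_right _ ha))
  have hsub : ∀ a ∈ A ⊓ C, ∀ b ∈ A ⊓ C, σ (a - b) = σ a - σ b := by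
    intro a ha b hb
    have := hσ 1 (-1) a ha b hb
    rw [map_one, map_neg, map_one] at this
    rw [show a - b = 1 * a + -1 * b by ring, this]; ring
  classical
  choose! ρ hρ using hC
  obtain ⟨W', hW'⟩ := eC (fun c => σ (c - ρ c * w) + Ideal.Quotient.mk J (W * ρ c)) (by
    intro α β a ha b hb
    have hab : α * a + β * b ∈ C := C.add_mem (C.mul_mem_left _ ha) (C.mul_mem_left _ hb)
    set e := ρ (α * a + β * b) - (α * ρ a + β * ρ b) with he
    have h1 := hρ _ hab
    have h2 := (A ⊓ C).add_mem ((A ⊓ C).mul_mem_left α (hρ a ha)) ((A ⊓ C).mul_mem_left β (hρ b hb))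
    have h3 : e * w ∈ A ⊓ C := by
      have := (A ⊓ C).sub_mem h2 h1
      convert this using 1
      rw [he]; ring
    have h4 : σ (e * w) = Ideal.Quotient.mk J (W * e) := hW e (hback e h3)
    have h5 : α * a + β * b - ρ (α * a + β * b) * w =
        (α * (a - ρ a * w) + β * (b - ρ b * w)) - e * w := by rw [he]; ring
    have h6 : ρ (α * a + β * b) = e + (α * ρ a + β * ρ b) := by rw [he]; ring
    rw [h5, hsub _ h2 _ h3, hσ _ _ _ (hρ a ha) _ (hρ b hb), h4, h6]
    simp only [map_mul, map_add]
    ring) (by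
    intro a ha
    have h1 := hρ _ (hJC ha)
    have h2 : a ∈ A ⊓ C := ⟨hJA ha, hJC ha⟩
    have h3 : ρ a * w ∈ A ⊓ C := by
      have := (A ⊓ C).sub_mem h2 h1
      convert this using 1; ring
    have h4 : σ (ρ a * w) = Ideal.Quotient.mk J (W * ρ a) := hW _ (hback _ h3)
    rw [hsub _ h2 _ h3, h4, hσ0 a ha]; ring)
  refine ⟨W', fun d hd => ?_⟩
  have h1 := hρ _ hd.2
  have h3 : ρ d * w ∈ A ⊓ C := by
    have := (A ⊓ C).sub_mem hd h1
    convert this using 1; ring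
  have h4 : σ (ρ d * w) = Ideal.Quotient.mk J (W * ρ d) := hW _ (hback _ h3)
  have h5 := hW' d hd.2
  rw [hsub _ hd _ h3, h4] at h5
  rw [← h5]; ring

end Link


section Link2

lemma exists_gcd {S : Type} [CommRing S] [IsDomain S] [UniqueFactorizationMonoid S]
    [IsNoetherianRing S] (D : Ideal S) (hD : D ≠ ⊥) :
    ∃ G, G ≠ 0 ∧ (∀ d ∈ D, G ∣ d) ∧ ∀ a b, (∀ d ∈ D, a * G ∣ b * d) → a ∣ b := by
  classical
  obtain ⟨inst⟩ : Nonempty (NormalizedGCDMonoid S) := by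
    let i : NormalizationMonoid S := Classical.choice inferInstance
    exact ⟨UniqueFactorizationMonoid.toNormalizedGCDMonoid S⟩
  obtain ⟨T, hT⟩ := (isNoetherianRing_iff_ideal_fg S).1 inferInstance D
  have hG : T.gcd id ≠ 0 := by
    intro h
    rw [Finset.gcd_eq_zero_iff] at h
    apply hD
    rw [← hT]
    exact Submodule.span_eq_bot.2 h
  refine ⟨T.gcd id, hG, ?_, ?_⟩
  · intro d hd
    have : D ≤ Ideal.span {T.gcd id} := by
      rw [← hT]
      refine Submodule.span_le.2 fun t ht => ?_
      exact Ideal.mem_span_singleton.2 (Finset.gcd_dvd ht)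
    exact Ideal.mem_span_singleton.1 (this hd)
  · intro a b h
    have h1 : a * T.gcd id ∣ T.gcd (fun d => b * id d) :=
      Finset.dvd_gcd fun d hd => h d (by rw [← hT]; exact Submodule.subset_span hd)
    have h2 := h1.trans (Finset.gcd_mul_left' T id b).dvd
    exact (mul_dvd_mul_iff_right hG).1 h2

variable {R : Type} [CommRing R]

lemma linkV [IsNoetherianRing R] {J D E : Ideal R} {Δ : R} (hE : E.IsPrime)
    (hufd : UniqueFactorizationMonoid (R ⧸ E)) (hΔ : LinkElt J E Δ)
    (hJD : J ≤ D) (hJE : J ≤ E) (hExt : ExtProp J D) (hDE : ¬ D ≤ E) :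
    ∃ w, Submodule.colon J (D : Set R) ⊔ Ideal.span {w} = Submodule.colon J ((D ⊓ E : Ideal R) : Set R)
      ∧ ∀ r, r ∈ E ↔ r * w ∈ Submodule.colon J (D : Set R) := by
  obtain ⟨hΔ1, hΔ2⟩ := hΔ
  let π := Ideal.Quotient.mk E
  obtain ⟨G', hG0, hGd, hGc⟩ := exists_gcd (D.map π) (by
    intro h
    apply hDE
    intro d hd
    rw [← Ideal.Quotient.eq_zero_iff_mem]
    have := Ideal.mem_map_of_mem π hd
    rw [h] at this
    exact this)
  obtain ⟨G, rfl⟩ := Ideal.Quotient.mk_surjective G'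
  have hGE : G ∉ E := fun h => hG0 (Ideal.Quotient.eq_zero_iff_mem.2 h)
  have hs : ∀ d ∈ D, ∃ s, d - G * s ∈ E := by
    intro d hd
    obtain ⟨s', hs'⟩ := hGd _ (Ideal.mem_map_of_mem π hd)
    obtain ⟨s, rfl⟩ := Ideal.Quotient.mk_surjective s'
    refine ⟨s, ?_⟩
    rw [← Ideal.Quotient.eq, map_mul]
    exact hs'
  choose! s hs using hs
  have hcan : ∀ r, G * r ∈ E → r ∈ E := fun r hr => (hE.mem_or_mem hr).resolve_left hGE
  have hΔJ : ∀ e ∈ E, Δ * e ∈ J := fun e he => by rw [mul_comm]; exact (hΔ1 e).2 he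
  have hgcd : ∀ a b, (∀ d ∈ D, ∃ c, b * s d - a * c ∈ E) → ∃ c, b - a * c ∈ E := by
    intro a b h
    have : π a ∣ π b := by
      apply hGc
      intro d hd
      obtain ⟨d0, hd0, rfl⟩ := (Ideal.mem_map_iff_of_surjective π Ideal.Quotient.mk_surjective).1 hd
      obtain ⟨c, hc⟩ := h d0 hd0
      refine ⟨π c, ?_⟩
      have : b * d0 - a * G * c ∈ E := by
        have e : b * d0 - a * G * c = b * (d0 - G * s d0) + G * (b * s d0 - a * c) := by ring
        rw [e]
        exact E.add_mem (E.mul_mem_left _ (hs d0 hd0)) (E.mul_mem_left _ hc)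
      rw [← Ideal.Quotient.eq] at this
      simpa only [map_mul] using this
    obtain ⟨c', hc'⟩ := this
    obtain ⟨c, rfl⟩ := Ideal.Quotient.mk_surjective c'
    refine ⟨c, ?_⟩
    rw [← Ideal.Quotient.eq, map_mul]
    exact hc'
  obtain ⟨w, hw⟩ := hExt (fun d => Ideal.Quotient.mk J (Δ * s d)) (by
    intro α β a ha b hb
    have hab : α * a + β * b ∈ D := D.add_mem (D.mul_mem_left _ ha) (D.mul_mem_left _ hb)
    rw [← map_mul, ← map_mul, ← map_add, Ideal.Quotient.eq]
    have : Δ * s (α * a + β * b) - (α * (Δ * s a) + β * (Δ * s b)) =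
      Δ * (s (α * a + β * b) - (α * s a + β * s b)) := by ring
    rw [this]
    apply hΔJ
    apply hcan
    have : G * (s (α * a + β * b) - (α * s a + β * s b)) =
      α * (a - G * s a) + β * (b - G * s b) - (α * a + β * b - G * s (α * a + β * b)) := by ring
    rw [this]
    exact E.sub_mem (E.add_mem (E.mul_mem_left _ (hs a ha)) (E.mul_mem_left _ (hs b hb))) (hs _ hab))
    (by
    intro a ha
    rw [Ideal.Quotient.eq_zero_iff_mem]
    apply hΔJ
    apply hcan
    have : G * s a = a - (a - G * s a) := by ring
    rw [this]
    exact E.sub_mem (hJE ha) (hs a (hJD ha)))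
  have hw' : ∀ d ∈ D, Δ * s d - w * d ∈ J := fun d hd => Ideal.Quotient.eq.1 (hw d hd)
  obtain ⟨d0, hd0, hd0E⟩ := SetLike.not_le_iff_exists.1 hDE
  have hs0 : s d0 ∉ E := by
    intro h
    apply hd0E
    have : d0 = (d0 - G * s d0) + G * s d0 := by ring
    rw [this]
    exact E.add_mem (hs d0 hd0) (E.mul_mem_left _ h)
  refine ⟨w, le_antisymm (sup_le ?_ ?_) ?_, ?_⟩
  · intro t ht
    rw [mem_cl] at ht ⊢
    exact fun g hg => ht g hg.1
  · rw [Ideal.span_singleton_le_iff_mem, mem_cl]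
    rintro d ⟨hd, hdE⟩
    have h1 : s d ∈ E := by
      apply hcan
      have : G * s d = d - (d - G * s d) := by ring
      rw [this]
      exact E.sub_mem hdE (hs d hd)
    have : w * d = Δ * s d - (Δ * s d - w * d) := by ring
    rw [this]
    exact J.sub_mem (hΔJ _ h1) (hw' d hd)
  · intro t ht
    rw [mem_cl] at ht
    have hτ : ∀ d ∈ D, ∃ c, t * d - c * Δ ∈ J := by
      intro d hd
      apply hΔ2
      intro e he
      rw [mul_assoc]
      exact ht _ ⟨D.mul_mem_right _ hd, E.mul_mem_left _ he⟩
    choose! τ hτ using hτ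
    have hcross : ∀ d ∈ D, τ d0 * s d - s d0 * τ d ∈ E := by
      intro d hd
      apply hcan
      have h1 : τ d0 * d - τ d * d0 ∈ E := by
        rw [← hΔ1]
        have : (τ d0 * d - τ d * d0) * Δ = d0 * (t * d - τ d * Δ) - d * (t * d0 - τ d0 * Δ) := by ring
        rw [this]
        exact J.sub_mem (J.mul_mem_left _ (hτ d hd)) (J.mul_mem_left _ (hτ d0 hd0))
      have : G * (τ d0 * s d - s d0 * τ d) =
        (τ d0 * d - τ d * d0) - τ d0 * (d - G * s d) + τ d * (d0 - G * s d0) := by ring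
      rw [this]
      exact E.add_mem (E.sub_mem h1 (E.mul_mem_left _ (hs d hd))) (E.mul_mem_left _ (hs d0 hd0))
    obtain ⟨c, hc⟩ := hgcd (s d0) (τ d0) (fun d hd => ⟨_, hcross d hd⟩)
    refine mem_sup_span.2 ⟨c, mem_cl.2 fun d hd => ?_⟩
    have h1 : τ d - c * s d ∈ E := by
      have : s d0 * (τ d - c * s d) = (τ d0 - s d0 * c) * s d - (τ d0 * s d - s d0 * τ d) := by ring
      refine (hE.mem_or_mem (x := s d0) ?_).resolve_left hs0
      rw [this]
      exact E.sub_mem (E.mul_mem_right _ hc) (hcross d hd)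
    have : (t - c * w) * d = (t * d - τ d * Δ) + Δ * (τ d - c * s d) + c * (Δ * s d - w * d) := by ring
    rw [this]
    exact J.add_mem (J.add_mem (hτ d hd) (hΔJ _ h1)) (J.mul_mem_left _ (hw' d hd))
  · intro r
    rw [mem_cl]
    constructor
    · intro hr d hd
      have : r * w * d = s d * (Δ * r) - r * (Δ * s d - w * d) := by ring
      rw [this]
      exact J.sub_mem (J.mul_mem_left _ (hΔJ _ hr)) (J.mul_mem_left _ (hw' d hd))
    · intro h
      have h1 : r * s d0 ∈ E := by
        rw [← hΔ1]
        have : r * s d0 * Δ = r * w * d0 + r * (Δ * s d0 - w * d0) := by ring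
        rw [this]
        exact J.add_mem (h d0 hd0) (J.mul_mem_left _ (hw' d0 hd0))
      exact (hE.mem_or_mem h1).resolve_right hs0

/-- `x, y` is a regular sequence modulo `C = (z, q)`. -/
lemma reg_mod {x y z q a b : R} (hA : (Ideal.span {x, y}).IsPrime)
    (hAz : (Ideal.span {x, y} ⊔ Ideal.span {z}).IsPrime) (hxy : RegPair x y)
    (hz : z ∉ Ideal.span {x, y}) (hq : q ∉ Ideal.span {x, y} ⊔ Ideal.span {z})
    (h : x * b - y * a ∈ Ideal.span {z, q}) :
    ∃ r, a - x * r ∈ Ideal.span {z, q} ∧ b - y * r ∈ Ideal.span {z, q} := by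
  have hx : x ∈ Ideal.span {x, y} := Ideal.subset_span (by simp)
  have hy : y ∈ Ideal.span {x, y} := Ideal.subset_span (by simp)
  obtain ⟨α, β, h⟩ := mem_pair_iff.1 h
  have h1 : β * q ∈ Ideal.span {x, y} ⊔ Ideal.span {z} := by
    refine mem_sup_span.2 ⟨-α, ?_⟩
    have : β * q - -α * z = x * b - y * a := by rw [h]; ring
    rw [this]
    exact Ideal.sub_mem _ (Ideal.mul_mem_right _ _ hx) (Ideal.mul_mem_right _ _ hy)
  obtain ⟨β3, hβ⟩ := mem_sup_span.1 ((hAz.mem_or_mem h1).resolve_right hq)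
  obtain ⟨β1, β2, hβ⟩ := mem_pair_iff.1 hβ
  have h2 : (α + β3 * q) * z ∈ Ideal.span {x, y} := by
    refine mem_pair_iff.2 ⟨b - β1 * q, -(a + β2 * q), ?_⟩
    linear_combination -h - q * hβ
  obtain ⟨α1, α2, hα⟩ := mem_pair_iff.1 ((hA.mem_or_mem h2).resolve_right hz)
  obtain ⟨r, hr1, hr2⟩ := hxy (b - β1 * q - α1 * z) (a + β2 * q + α2 * z)
    (by linear_combination h + q * hβ + z * hα)
  exact ⟨r, mem_pair_iff.2 ⟨-α2, -β2, by linear_combination hr2⟩,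
    mem_pair_iff.2 ⟨α1, β1, by linear_combination hr1⟩⟩

lemma pair_not_le {x y : R} {C : Ideal R} (h : ¬ Ideal.span {x, y} ≤ C) : x ∉ C ∨ y ∉ C := by
  by_contra hcon
  push Not at hcon
  apply h
  rw [Ideal.span_le]
  rintro r (rfl | rfl)
  · exact hcon.1
  · exact hcon.2

lemma linkU {J : Ideal R} {x y u v z q Δ : R}
    (hA : (Ideal.span {x, y}).IsPrime) (hAz : (Ideal.span {x, y} ⊔ Ideal.span {z}).IsPrime)
    (hB : (Ideal.span {u, v}).IsPrime) (hBz : (Ideal.span {u, v} ⊔ Ideal.span {z}).IsPrime)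
    (hC : (Ideal.span {z, q}).IsPrime)
    (hxy : RegPair x y) (huv : RegPair u v)
    (hzA : z ∉ Ideal.span {x, y}) (hqA : q ∉ Ideal.span {x, y} ⊔ Ideal.span {z})
    (hzB : z ∉ Ideal.span {u, v}) (hqB : q ∉ Ideal.span {u, v} ⊔ Ideal.span {z})
    (hAC : ¬ Ideal.span {x, y} ≤ Ideal.span {z, q}) (hBC : ¬ Ideal.span {u, v} ≤ Ideal.span {z, q})
    (hΔ : LinkElt J (Ideal.span {z, q}) Δ) :
    Submodule.colon J ((Ideal.span {x, y} ⊓ Ideal.span {u, v} : Ideal R) : Set R) ⊔ Ideal.span {Δ} =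
      Submodule.colon J ((Ideal.span {x, y} ⊓ Ideal.span {u, v} ⊓ Ideal.span {z, q} : Ideal R) : Set R)
      ∧ ∀ r, r ∈ Ideal.span {z, q} ↔ r * Δ ∈
        Submodule.colon J ((Ideal.span {x, y} ⊓ Ideal.span {u, v} : Ideal R) : Set R) := by
  obtain ⟨hΔ1, hΔ2⟩ := hΔ
  have hx : x ∈ Ideal.span {x, y} := Ideal.subset_span (by simp)
  have hy : y ∈ Ideal.span {x, y} := Ideal.subset_span (by simp)
  have hu : u ∈ Ideal.span {u, v} := Ideal.subset_span (by simp)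
  have hv : v ∈ Ideal.span {u, v} := Ideal.subset_span (by simp)
  set A := Ideal.span {x, y} with hAdef
  set B := Ideal.span {u, v} with hBdef
  set C := Ideal.span {z, q} with hCdef
  have hprod : ∀ a ∈ A, ∀ b ∈ B, a * b ∈ A ⊓ B := fun a ha b hb =>
    ⟨A.mul_mem_right _ ha, B.mul_mem_left _ hb⟩
  have hΔJ : ∀ e ∈ C, Δ * e ∈ J := fun e he => by rw [mul_comm]; exact (hΔ1 e).2 he
  -- good elements
  obtain ⟨a0, ha0, ha0C⟩ := SetLike.not_le_iff_exists.1 hAC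
  obtain ⟨b0, hb0, hb0C⟩ := SetLike.not_le_iff_exists.1 hBC
  have hd0C : a0 * b0 ∉ C := fun h => (hC.mem_or_mem h).elim ha0C hb0C
  refine ⟨le_antisymm (sup_le ?_ ?_) ?_, ?_⟩
  · intro t ht
    rw [mem_cl] at ht ⊢
    exact fun g hg => ht g hg.1
  · rw [Ideal.span_singleton_le_iff_mem, mem_cl]
    exact fun g hg => hΔJ g hg.2
  · intro t ht
    rw [mem_cl] at ht
    have hτ : ∀ d ∈ A ⊓ B, ∃ c, t * d - c * Δ ∈ J := by
      intro d hd
      apply hΔ2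
      intro e he
      rw [mul_assoc]
      exact ht _ ⟨Ideal.mul_mem_right _ _ hd, C.mul_mem_left _ he⟩
    choose! τ hτ using hτ
    -- linear relations
    have hlin : ∀ d ∈ A ⊓ B, ∀ d' ∈ A ⊓ B, ∀ r r', r * d = r' * d' → r * τ d - r' * τ d' ∈ C := by
      intro d hd d' hd' r r' hr
      rw [← hΔ1]
      have : (r * τ d - r' * τ d') * Δ = r' * (t * d' - τ d' * Δ) - r * (t * d - τ d * Δ) := by
        linear_combination t * hr
      rw [this]
      exact J.sub_mem (J.mul_mem_left _ (hτ _ hd')) (J.mul_mem_left _ (hτ _ hd))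
    have hr : ∀ b ∈ B, ∃ r, τ (x * b) - x * r ∈ C ∧ τ (y * b) - y * r ∈ C := fun b hb =>
      reg_mod hA hAz hxy hzA hqA
        (hlin _ (hprod y hy b hb) _ (hprod x hx b hb) x y (by ring))
    obtain ⟨ru, hru1, hru2⟩ := hr u hu
    obtain ⟨rv, hrv1, hrv2⟩ := hr v hv
    have hcr : u * rv - v * ru ∈ C := by
      have hg : ∀ a ∈ A, a ∉ C → τ (a * u) - a * ru ∈ C → τ (a * v) - a * rv ∈ C →
          u * rv - v * ru ∈ C := by
        intro a ha haC h1 h2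
        have h3 := hlin _ (hprod a ha u hu) _ (hprod a ha v hv) v u (by ring)
        refine (hC.mem_or_mem (x := a) ?_).resolve_left haC
        have : a * (u * rv - v * ru) = v * (τ (a * u) - a * ru) - u * (τ (a * v) - a * rv)
          - (v * τ (a * u) - u * τ (a * v)) := by ring
        rw [this]
        exact C.sub_mem (C.sub_mem (C.mul_mem_left _ h1) (C.mul_mem_left _ h2)) h3
      rcases pair_not_le hAC with h | h
      · exact hg x hx h hru1 hrv1
      · exact hg y hy h hru2 hrv2
    obtain ⟨ρ, hρ1, hρ2⟩ := reg_mod hB hBz huv hzB hqB hcr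
    have hex : ∃ d0 ∈ A ⊓ B, d0 ∉ C ∧ τ d0 - d0 * ρ ∈ C := by
      have hg : ∀ a ∈ A, a ∉ C → τ (a * u) - a * ru ∈ C → τ (a * v) - a * rv ∈ C →
          ∃ d0 ∈ A ⊓ B, d0 ∉ C ∧ τ d0 - d0 * ρ ∈ C := by
        intro a ha haC h1 h2
        rcases pair_not_le hBC with h | h
        · refine ⟨a * u, hprod a ha u hu, fun h' => (hC.mem_or_mem h').elim haC h, ?_⟩
          have : τ (a * u) - a * u * ρ = (τ (a * u) - a * ru) + a * (ru - u * ρ) := by ring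
          rw [this]
          exact C.add_mem h1 (C.mul_mem_left _ hρ1)
        · refine ⟨a * v, hprod a ha v hv, fun h' => (hC.mem_or_mem h').elim haC h, ?_⟩
          have : τ (a * v) - a * v * ρ = (τ (a * v) - a * rv) + a * (rv - v * ρ) := by ring
          rw [this]
          exact C.add_mem h2 (C.mul_mem_left _ hρ2)
      rcases pair_not_le hAC with h | h
      · exact hg x hx h hru1 hrv1
      · exact hg y hy h hru2 hrv2
    obtain ⟨d0, hd0, hd0C, hd0τ⟩ := hex
    refine mem_sup_span.2 ⟨ρ, mem_cl.2 fun d hd => ?_⟩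
    have h1 : τ d - ρ * d ∈ C := by
      refine (hC.mem_or_mem (x := d0) ?_).resolve_left hd0C
      have h2 := hlin d hd d0 hd0 d0 d (by ring)
      have : d0 * (τ d - ρ * d) = (d0 * τ d - d * τ d0) + d * (τ d0 - d0 * ρ) := by ring
      rw [this]
      exact C.add_mem h2 (C.mul_mem_left _ hd0τ)
    have : (t - ρ * Δ) * d = (t * d - τ d * Δ) + Δ * (τ d - ρ * d) := by ring
    rw [this]
    exact J.add_mem (hτ d hd) (hΔJ _ h1)
  · intro r
    rw [mem_cl]
    constructor
    · intro hr d hd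
      rw [mul_comm r, mul_assoc]
      exact hΔJ _ (C.mul_mem_right _ hr)
    · intro h
      have h1 := h _ (hprod a0 ha0 b0 hb0)
      have : r * Δ * (a0 * b0) = r * (a0 * b0) * Δ := by ring
      rw [this, hΔ1] at h1
      exact (hC.mem_or_mem h1).resolve_right hd0C

end Link2


section Final

variable {k : Type} [Field k] {N : ℕ}

lemma pdle_reg {f1 f2 : MvPolynomial (Fin N) k} (hf : RegPair f1 f2) :
    PDLE (Ideal.span {f1, f2}) 2 := by
  refine pdle_right (X := Ideal.span {f1}) (Y := Ideal.span {f1}) f2 ?_ (span_pair_sup f1 f2).symm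
    pdle_single (pdle_single.mono (by norm_num))
  intro r
  rw [Ideal.mem_span_singleton, Ideal.mem_span_singleton]
  exact ⟨fun h => h.mul_right _, fun ⟨c, hc⟩ => by
    obtain ⟨t, -, ht⟩ := hf c r (by rw [← hc, mul_comm])
    exact ⟨t, ht⟩⟩

lemma pdle_link {J C : Ideal (MvPolynomial (Fin N) k)} {Δ : MvPolynomial (Fin N) k}
    (hJ : PDLE J 2) (hC : PDLE C 2)
    (hΔ : LinkElt J C Δ) : PDLE (Submodule.colon J (C : Set (MvPolynomial (Fin N) k))) 3 := by
  refine pdle_right (X := J) (Y := C) Δ (fun r => (hΔ.1 r).symm) ?_ hC (hJ.mono (by norm_num))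
  ext t
  rw [mem_sup_span, mem_cl]
  constructor
  · rintro ⟨c, hc⟩ g hg
    have h1 : (t - c * Δ) * g ∈ J := J.mul_mem_right _ hc
    have h2 : c * (g * Δ) ∈ J := J.mul_mem_left _ ((hΔ.1 g).2 hg)
    have : t * g = (t - c * Δ) * g + c * (g * Δ) := by ring
    rw [this]
    exact J.add_mem h1 h2
  · exact hΔ.2 t

lemma pdle_V {J D E : Ideal (MvPolynomial (Fin N) k)} {Δ : MvPolynomial (Fin N) k}
    (hE : IsLin E) (hE2 : PDLE E 2) (hΔ : LinkElt J E Δ) (hJD : J ≤ D) (hJE : J ≤ E)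
    (hExt : ExtProp J D) (hD : PDLE (Submodule.colon J (D : Set (MvPolynomial (Fin N) k))) 3) :
    PDLE (Submodule.colon J ((D ⊓ E : Ideal _) : Set (MvPolynomial (Fin N) k))) 3 := by
  by_cases hDE : D ≤ E
  · rwa [inf_eq_left.2 hDE]
  · obtain ⟨w, h1, h2⟩ := linkV hE.isPrime hE.ufd hΔ hJD hJE hExt hDE
    exact pdle_right w h2 h1 hE2 hD

lemma extProp_AC {J A : Ideal (MvPolynomial (Fin N) k)} {z q : MvPolynomial (Fin N) k}
    (hA : A.IsPrime) (hJA : J ≤ A) (hJC : J ≤ Ideal.span {z, q})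
    (h : z ∈ A ∨ q ∈ A ⊔ Ideal.span {z})
    (eA : ExtProp J A) (eC : ExtProp J (Ideal.span {z, q})) :
    ExtProp J (A ⊓ Ideal.span {z, q}) := by
  by_cases hCA : Ideal.span {z, q} ≤ A
  · rwa [inf_eq_right.2 hCA]
  have hzC : z ∈ Ideal.span {z, q} := Ideal.subset_span (by simp)
  have hqC : q ∈ Ideal.span {z, q} := Ideal.subset_span (by simp)
  by_cases hz : z ∈ A
  · have hqA : q ∉ A := by
      intro hq
      apply hCA
      rw [Ideal.span_le]
      rintro r (rfl | rfl)
      · exact hz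
      · exact hq
    refine extProp_inf hA hJA hJC hqC hqA ?_ eA eC
    intro c hc
    obtain ⟨a, b, rfl⟩ := mem_pair_iff.1 hc
    refine ⟨b, ?_⟩
    rw [add_sub_cancel_right]
    exact ⟨A.mul_mem_left _ hz, Ideal.mul_mem_left _ _ hzC⟩
  · have hq := h.resolve_left hz
    obtain ⟨e, he⟩ := mem_sup_span.1 hq
    refine extProp_inf hA hJA hJC hzC hz ?_ eA eC
    intro c hc
    obtain ⟨a, b, rfl⟩ := mem_pair_iff.1 hc
    refine ⟨a + b * e, ?_⟩
    have : a * z + b * q - (a + b * e) * z = b * (q - e * z) := by ring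
    rw [this]
    exact ⟨A.mul_mem_left _ he, Ideal.mul_mem_left _ _
      (Ideal.sub_mem _ hqC (Ideal.mul_mem_left _ _ hzC))⟩

lemma not_le_of_height {A C : Ideal (MvPolynomial (Fin N) k)} (hA : A.IsPrime) (hC : C.IsPrime)
    (hAh : idealHeight A = 2) (hCh : idealHeight C = 2) {z : MvPolynomial (Fin N) k}
    (hzC : z ∈ C) (hzA : z ∉ A) : ¬ A ≤ C := by
  intro h
  rw [idealHeight_prime hA] at hAh
  rw [idealHeight_prime hC] at hCh
  have hlt : (⟨A, hA⟩ : {q : Ideal (MvPolynomial (Fin N) k) // q.IsPrime}) < ⟨C, hC⟩ :=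
    lt_of_le_not_ge h fun h' => hzA (h' hzC)
  have := Order.height_add_one_le hlt
  rw [hAh, hCh] at this
  exact absurd this (by decide)

lemma pdle_i {f1 f2 x y u v z q : MvPolynomial (Fin N) k}
    (hf : RegPair f1 f2) (hf1 : f1 ≠ 0) (hf2 : f2 ≠ 0)
    (hx : x.IsHomogeneous 1) (hy : y.IsHomogeneous 1) (hu : u.IsHomogeneous 1)
    (hv : v.IsHomogeneous 1) (hz : z.IsHomogeneous 1)
    (hA : IsLin (Ideal.span {x, y})) (hB : IsLin (Ideal.span {u, v}))
    (hxyht : idealHeight (Ideal.span {x, y}) = 2)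
    (huvht : idealHeight (Ideal.span {u, v}) = 2)
    (hzqht : idealHeight (Ideal.span {z, q}) = 2)
    (hJA : Ideal.span {f1, f2} ≤ Ideal.span {x, y})
    (hJB : Ideal.span {f1, f2} ≤ Ideal.span {u, v})
    (hJC : Ideal.span {f1, f2} ≤ Ideal.span {z, q})
    (h : z ∈ Ideal.span {x, y} ∨ q ∈ Ideal.span {x, y} ⊔ Ideal.span {z}) :
    PDLE (Submodule.colon (Ideal.span {f1, f2})
      ((Ideal.span {x, y} ⊓ Ideal.span {z, q} ⊓ Ideal.span {u, v} : Ideal _) :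
        Set (MvPolynomial (Fin N) k))) 3 := by
  have m1 : f1 ∈ Ideal.span {f1, f2} := Ideal.subset_span (by simp)
  have m2 : f2 ∈ Ideal.span {f1, f2} := Ideal.subset_span (by simp)
  obtain ⟨hx0, -, hxy⟩ := height_pair hxyht
  obtain ⟨hu0, -, huv⟩ := height_pair huvht
  obtain ⟨hz0, -, hzq⟩ := height_pair hzqht
  obtain ⟨ΔA, hΔA⟩ := exists_link hf hf1 hxy hx0 (hJA m1) (hJA m2)
  obtain ⟨ΔB, hΔB⟩ := exists_link hf hf1 huv hu0 (hJB m1) (hJB m2)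
  obtain ⟨ΔC, hΔC⟩ := exists_link hf hf1 hzq hz0 (hJC m1) (hJC m2)
  have eA := extProp_pair hf hf1 hf2 hxy (hJA m1) (hJA m2)
  have eC := extProp_pair hf hf1 hf2 hzq (hJC m1) (hJC m2)
  have hC3 := pdle_link (pdle_reg hf) (pdle_lin_pair hz) hΔC
  have hAC := pdle_V hA (pdle_lin_pair hx) hΔA hJC hJA eC hC3
  rw [inf_comm] at hAC
  exact pdle_V hB (pdle_lin_pair hu) hΔB (le_inf hJA hJC) hJB
    (extProp_AC hA.isPrime hJA hJC h eA eC) hAC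

lemma pdle_iii {f1 f2 x y u v z q : MvPolynomial (Fin N) k}
    (hf : RegPair f1 f2) (hf1 : f1 ≠ 0) (hf2 : f2 ≠ 0)
    (hx : x.IsHomogeneous 1) (hu : u.IsHomogeneous 1) (hz : z.IsHomogeneous 1)
    (hA : IsLin (Ideal.span {x, y})) (hB : IsLin (Ideal.span {u, v}))
    (hC : (Ideal.span {z, q}).IsPrime)
    (hxyht : idealHeight (Ideal.span {x, y}) = 2)
    (huvht : idealHeight (Ideal.span {u, v}) = 2)
    (hzqht : idealHeight (Ideal.span {z, q}) = 2)
    (hJA : Ideal.span {f1, f2} ≤ Ideal.span {x, y})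
    (hJB : Ideal.span {f1, f2} ≤ Ideal.span {u, v})
    (hJC : Ideal.span {f1, f2} ≤ Ideal.span {z, q})
    (h : ¬ (z ∈ Ideal.span {x, y} ∨ q ∈ Ideal.span {x, y} ⊔ Ideal.span {z}))
    (h' : ¬ (z ∈ Ideal.span {u, v} ∨ q ∈ Ideal.span {u, v} ⊔ Ideal.span {z})) :
    PDLE (Submodule.colon (Ideal.span {f1, f2})
      ((Ideal.span {x, y} ⊓ Ideal.span {u, v} ⊓ Ideal.span {z, q} : Ideal _) :
        Set (MvPolynomial (Fin N) k))) 3 := by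
  have m1 : f1 ∈ Ideal.span {f1, f2} := Ideal.subset_span (by simp)
  have m2 : f2 ∈ Ideal.span {f1, f2} := Ideal.subset_span (by simp)
  have hzC : z ∈ Ideal.span {z, q} := Ideal.subset_span (by simp)
  obtain ⟨hx0, -, hxy⟩ := height_pair hxyht
  obtain ⟨hu0, -, huv⟩ := height_pair huvht
  obtain ⟨hz0, -, hzq⟩ := height_pair hzqht
  obtain ⟨ΔA, hΔA⟩ := exists_link hf hf1 hxy hx0 (hJA m1) (hJA m2)
  obtain ⟨ΔB, hΔB⟩ := exists_link hf hf1 huv hu0 (hJB m1) (hJB m2)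
  obtain ⟨ΔC, hΔC⟩ := exists_link hf hf1 hzq hz0 (hJC m1) (hJC m2)
  have eA := extProp_pair hf hf1 hf2 hxy (hJA m1) (hJA m2)
  have hA3 := pdle_link (pdle_reg hf) (pdle_lin_pair hx) hΔA
  have hAB := pdle_V hB (pdle_lin_pair hu) hΔB hJA hJB eA hA3
  push Not at h h'
  obtain ⟨e1, e2⟩ := linkU hA.isPrime (hA.sup (isLin_singleton hz)).isPrime
    hB.isPrime (hB.sup (isLin_singleton hz)).isPrime hC hxy huv h.1 h.2 h'.1 h'.2
    (not_le_of_height hA.isPrime hC hxyht hzqht hzC h.1)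
    (not_le_of_height hB.isPrime hC huvht hzqht hzC h'.1) hΔC
  exact pdle_right ΔC e2 e1 (pdle_lin_pair hz) hAB

end Final

theorem statement_15
    {k : Type} [Field k] [IsAlgClosed k] {N : ℕ}
    (f₁ f₂ f₃ : MvPolynomial (Fin N) k)
    (hf₁ : f₁.IsHomogeneous 3) (hf₂ : f₂.IsHomogeneous 3) (hf₃ : f₃.IsHomogeneous 3)
    (hIht : idealHeight (Ideal.span {f₁, f₂, f₃}) = 2)
    (hht₁₂ : idealHeight (Ideal.span {f₁, f₂}) = 2)
    (hht₁₃ : idealHeight (Ideal.span {f₁, f₃}) = 2)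
    (hht₂₃ : idealHeight (Ideal.span {f₂, f₃}) = 2)
    (x y u v z q : MvPolynomial (Fin N) k)
    (hx : x.IsHomogeneous 1) (hy : y.IsHomogeneous 1) (hu : u.IsHomogeneous 1)
    (hv : v.IsHomogeneous 1) (hz : z.IsHomogeneous 1) (hq : q.IsHomogeneous 2)
    (hxy : (Ideal.span {x, y}).IsPrime) (hxyht : idealHeight (Ideal.span {x, y}) = 2)
    (huv : (Ideal.span {u, v}).IsPrime) (huvht : idealHeight (Ideal.span {u, v}) = 2)
    (hzq : (Ideal.span {z, q}).IsPrime) (hzqht : idealHeight (Ideal.span {z, q}) = 2)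
    (hK : Ideal.span {x, y} ⊓ Ideal.span {u, v} ⊓ Ideal.span {z, q} = unmixedPart (Ideal.span {f₁, f₂, f₃}) ∨
          Ideal.span {x, y} ⊓ Ideal.span {u, v} ⊓ Ideal.span {z, q} = Submodule.colon (Ideal.span {f₁, f₂}) (Ideal.span {f₃})) :
    pdQuotLE (Ideal.span {f₁, f₂, f₃}) 5 := by
  obtain ⟨hf1, hf2, hf⟩ := height_pair hht₁₂
  obtain ⟨hz0, -, -⟩ := height_pair hzqht
  have hA : IsLin (Ideal.span {x, y}) := isLin_pair hx hy
  have hB : IsLin (Ideal.span {u, v}) := isLin_pair hu hv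
  have hI : Ideal.span {f₁, f₂} ⊔ Ideal.span {f₃} = Ideal.span {f₁, f₂, f₃} := by
    rw [← Ideal.span_union]
    congr 1
    ext r
    simp only [Set.mem_union, Set.mem_insert_iff, Set.mem_singleton_iff, or_assoc]
  have hL : PDLE (Submodule.colon (Ideal.span {f₁, f₂})
      (Ideal.span {f₃} : Set (MvPolynomial (Fin N) k))) 4 := by
    rcases hK with hK | hK
    · have hIK := le_unmixedPart (Ideal.span {f₁, f₂, f₃})
      rw [← hK] at hIK
      have hJK : Ideal.span {f₁, f₂} ≤ _ := le_trans (le_trans le_sup_left hI.le) hIK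
      have hJC := hJK.trans inf_le_right
      have hJA := hJK.trans (inf_le_left.trans inf_le_left)
      have hJB := hJK.trans (inf_le_left.trans inf_le_right)
      have e : Submodule.colon (Ideal.span {f₁, f₂})
          (Ideal.span {f₃} : Set (MvPolynomial (Fin N) k)) =
          Submodule.colon (Ideal.span {f₁, f₂})
          ((Ideal.span {x, y} ⊓ Ideal.span {u, v} ⊓ Ideal.span {z, q} : Ideal _) :
            Set (MvPolynomial (Fin N) k)) := by
        ext t
        rw [mem_colon_span, mem_cl]
        constructor
        · intro ht g hg
          rw [hK] at hg
          exact unmixed_mul hIht hht₁₂ ht hg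
        · intro ht
          exact ht f₃ (hIK (Ideal.subset_span (by simp)))
      rw [e]
      suffices h3 : PDLE _ 3 from h3.mono (by norm_num)
      by_cases h1 : z ∈ Ideal.span {x, y} ∨ q ∈ Ideal.span {x, y} ⊔ Ideal.span {z}
      · rw [inf_right_comm]
        exact pdle_i hf hf1 hf2 hx hy hu hv hz hA hB hxyht huvht hzqht hJA hJB hJC h1
      by_cases h2 : z ∈ Ideal.span {u, v} ∨ q ∈ Ideal.span {u, v} ⊔ Ideal.span {z}
      · rw [inf_comm (Ideal.span {x, y}), inf_right_comm]
        exact pdle_i hf hf1 hf2 hu hv hx hy hz hB hA huvht hxyht hzqht hJB hJA hJC h2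
      exact pdle_iii hf hf1 hf2 hx hu hz hA hB hzq hxyht huvht hzqht hJA hJB hJC h1 h2
    · rw [← hK]
      exact pdK hA hB (pdle_lin_pair hx) (pdle_lin_pair hu) hxyht huvht
        (hA.pdle_sup_pair (pdle_lin_pair hx) hu) hz hz0
  have := pdle_right f₃ (fun r => mem_colon_span) hI hL ((pdle_reg hf).mono (by norm_num))
  exact this.pdQuotLE

end
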